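/- arXiv:2308.16303 — 3 statements merged into one kernel-verified Lean document; each statement's English description precedes it below -/
import Mathlib

section
/- For every real number x ≥ 2, the prime counting function satisfies π(x) ~ x / log x as x → ∞, i.e., lim_{x→∞} π(x)·log(x)/x = 1. -/
open Filter

/-- The Fejér kernel on the real line, up to normalization. -/
noncomputable def fejerKernel (x : ℝ) : ℝ := (2 - 2 * Real.cos x) / x ^ 2

/-- The tent function, whose Fourier transform is the Fejér kernel. -/
def tent (t : ℝ) : ℝ := max 0 (1 - |t|)

lemma fejerKernel_nonneg (x : ℝ) : 0 ≤ fejerKernel x :=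
  div_nonneg (by linarith [Real.cos_le_one x]) (sq_nonneg x)

lemma fejerKernel_le (x : ℝ) : fejerKernel x ≤ 5 * (1 + x ^ 2)⁻¹ := by
  rcases eq_or_ne x 0 with rfl | hx
  · simp [fejerKernel]
  have hx2 : 0 < x ^ 2 := by positivity
  rw [fejerKernel, ← div_eq_mul_inv, div_le_div_iff₀ hx2 (by positivity)]
  nlinarith [Real.one_sub_sq_div_two_le_cos (x := x), Real.neg_one_le_cos x]

lemma measurable_fejerKernel : Measurable fejerKernel := by
  unfold fejerKernel
  fun_prop

lemma integrable_fejerKernel : MeasureTheory.Integrable fejerKernel := by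
  refine (integrable_inv_one_add_sq.const_mul 5).mono'
    measurable_fejerKernel.aestronglyMeasurable (.of_forall fun x ↦ ?_)
  rw [Real.norm_of_nonneg (fejerKernel_nonneg x)]
  exact fejerKernel_le x

lemma integral_fejerKernel_pos : 0 < ∫ x, fejerKernel x := by
  rw [MeasureTheory.integral_pos_iff_support_of_nonneg fejerKernel_nonneg integrable_fejerKernel]
  refine lt_of_lt_of_le ?_ (MeasureTheory.measure_mono (s := Set.Ioo 0 1) fun x hx ↦ ?_)
  · simp
  · have h : Real.cos x < 1 := by
      rw [← Real.cos_zero]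
      exact Real.cos_lt_cos_of_nonneg_of_le_pi le_rfl
        (hx.2.le.trans (by linarith [Real.pi_gt_three])) hx.1
    exact (div_pos (by linarith) (pow_pos hx.1 2)).ne'

lemma tent_nonneg (t : ℝ) : 0 ≤ tent t := le_max_left _ _

lemma tent_eq_zero {t : ℝ} (ht : 1 ≤ |t|) : tent t = 0 := max_eq_left (by linarith)

lemma continuous_tent : Continuous tent := by
  unfold tent
  fun_prop

lemma hasCompactSupport_tent : HasCompactSupport tent :=
  HasCompactSupport.of_support_subset_isCompact (isCompact_Icc (a := -1) (b := 1)) fun t ht ↦ by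
    by_contra h
    refine ht (tent_eq_zero ?_)
    rw [Set.mem_Icc, ← abs_le] at h
    linarith

lemma integral_tent_mul_cexp {x : ℝ} (hx : x ≠ 0) :
    ∫ t : ℝ, (tent t : ℂ) * Complex.exp (x * t * Complex.I) = fejerKernel x := by
  have hx' : (x : ℂ) ≠ 0 := by exact_mod_cast hx
  have hc : Continuous fun t : ℝ ↦ (tent t : ℂ) * Complex.exp (x * t * Complex.I) := by
    have := continuous_tent
    fun_prop
  have hsupp : ∫ t : ℝ, (tent t : ℂ) * Complex.exp (x * t * Complex.I) =
      ∫ t in (-1 : ℝ)..1, (tent t : ℂ) * Complex.exp (x * t * Complex.I) := by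
    rw [intervalIntegral.integral_of_le (by norm_num),
      MeasureTheory.setIntegral_eq_integral_of_forall_compl_eq_zero]
    intro t ht
    have : 1 ≤ |t| := by
      by_contra! h
      rw [abs_lt] at h
      exact ht ⟨h.1, h.2.le⟩
    simp [tent_eq_zero this]
  rw [hsupp, ← intervalIntegral.integral_add_adjacent_intervals
    (hc.intervalIntegrable (-1) 0) (hc.intervalIntegrable 0 1)]
  have hder (σ : ℂ) (t : ℝ) : HasDerivAt
      (fun t : ℝ ↦ (1 + σ * t) * Complex.exp (x * t * Complex.I) / (x * Complex.I) -
        σ * Complex.exp (x * t * Complex.I) / (x * Complex.I) ^ 2)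
      ((1 + σ * t) * Complex.exp (x * t * Complex.I)) t := by
    have h1 : HasDerivAt (fun t : ℝ ↦ (t : ℂ)) 1 t := Complex.ofRealCLM.hasDerivAt
    have h2 := ((h1.const_mul (x : ℂ)).mul_const Complex.I).cexp
    have h3 := (((h1.const_mul σ).const_add 1).mul h2).div_const (x * Complex.I)
    have h4 := (h2.const_mul σ).div_const ((x * Complex.I) ^ 2)
    convert! h3.sub h4 using 1
    field_simp
    ring
  have hintegral (σ : ℂ) (a b : ℝ) :=
    intervalIntegral.integral_eq_sub_of_hasDerivAt (a := a) (b := b)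
    (fun t _ ↦ hder σ t) (Continuous.intervalIntegrable (by fun_prop) _ _)
  have h1 : ∫ t in (-1 : ℝ)..0, (tent t : ℂ) * Complex.exp (x * t * Complex.I) =
      ∫ t in (-1 : ℝ)..0, (1 + 1 * t) * Complex.exp (x * t * Complex.I) := by
    refine intervalIntegral.integral_congr fun t ht ↦ ?_
    rw [Set.uIcc_of_le (by norm_num)] at ht
    have : tent t = 1 + t := by
      rw [tent, abs_of_nonpos ht.2, max_eq_right] <;> linarith [ht.1]
    simp [this]
  have h2 : ∫ t in (0 : ℝ)..1, (tent t : ℂ) * Complex.exp (x * t * Complex.I) =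
      ∫ t in (0 : ℝ)..1, (1 + (-1) * t) * Complex.exp (x * t * Complex.I) := by
    refine intervalIntegral.integral_congr fun t ht ↦ ?_
    rw [Set.uIcc_of_le (by norm_num)] at ht
    have : tent t = 1 - t := by
      rw [tent, abs_of_nonneg ht.1, max_eq_right] ; linarith [ht.2]
    simp [this, sub_eq_add_neg]
  have hI : Complex.I ^ 2 = -1 := Complex.I_sq
  rw [h1, h2, hintegral, hintegral, fejerKernel]
  push_cast
  have e1 := Complex.exp_mul_I x
  have e2 := Complex.exp_mul_I (-x)
  rw [Complex.cos_neg, Complex.sin_neg] at e2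
  simp only [mul_zero, zero_mul, Complex.exp_zero, mul_one, mul_neg, e1, e2, mul_pow, hI]
  field_simp
  ring

open MeasureTheory in
/-- If the Laplace transform of a bounded function `f` supported on `[0, ∞)` extends continuously
to the closed right half-plane, then the convolutions of `f` with rescaled Fejér kernels tend to
zero at infinity. -/
theorem tendsto_integral_mul_fejerKernel {f : ℝ → ℝ} (hf : Measurable f) {M : ℝ}
    (hM : ∀ u, |f u| ≤ M) (h0 : ∀ u < 0, f u = 0) {G : ℂ → ℂ}
    (hG : ContinuousOn G {s | 0 ≤ s.re})
    (hfG : ∀ s : ℂ, 0 < s.re → ∫ u : ℝ, (f u : ℂ) * Complex.exp (-s * u) = G s)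
    {a : ℝ} (ha : 0 < a) :
    Tendsto (fun y ↦ ∫ u, f u * fejerKernel (a * (y - u))) atTop (nhds 0) := by
  have hexp {δ : ℝ} (hδ : 0 ≤ δ) (u : ℝ) : |f u * Real.exp (-δ * u)| ≤ |f u| := by
    rcases lt_or_ge u 0 with hu | hu
    · simp [h0 u hu]
    · rw [abs_mul, Real.abs_exp]
      exact mul_le_of_le_one_right (abs_nonneg _) (Real.exp_le_one_iff.2 (by nlinarith))
  have hintegral {δ : ℝ} (hδ : 0 < δ) : Integrable fun u ↦ f u * Real.exp (-δ * u) := by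
    have h1 : IntegrableOn (fun u ↦ M * Real.exp (-δ * u)) (Set.Ici 0) :=
      ((integrableOn_Ici_iff_integrableOn_Ioi (by simp)).2
        (integrableOn_exp_mul_Ioi (by linarith) 0)).const_mul M
    refine ((integrable_indicator_iff measurableSet_Ici).2 h1).mono'
      (by fun_prop) (.of_forall fun u ↦ ?_)
    rcases lt_or_ge u 0 with hu | hu
    · simp [h0 u hu, hu]
    · rw [Set.indicator_of_mem (Set.mem_Ici.2 hu), norm_mul, Real.norm_eq_abs,
        Real.norm_eq_abs, Real.abs_exp]
      gcongr
      exact hM u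
  have hpar {δ : ℝ} (hδ : 0 < δ) (y : ℝ) :
      ((∫ u, f u * Real.exp (-δ * u) * fejerKernel (a * (y - u)) : ℝ) : ℂ) =
        ∫ t : ℝ, (tent t : ℂ) * Complex.exp (a * y * t * Complex.I) * G (δ + a * t * Complex.I) := by
    let H : ℝ → ℝ → ℂ := fun u t ↦ ((f u * Real.exp (-δ * u) : ℝ) : ℂ) *
      (tent t * Complex.exp ((a * (y - u) : ℝ) * t * Complex.I))
    have hH : Integrable (Function.uncurry H) (volume.prod volume) := by
      have htent : Integrable tent :=
        continuous_tent.integrable_of_hasCompactSupport hasCompactSupport_tent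
      have h1 := ((hintegral hδ).mul_prod htent).ofReal (𝕜 := ℂ)
      refine h1.mono ?_ (.of_forall fun p ↦ ?_)
      · have := continuous_tent.measurable
        refine Measurable.aestronglyMeasurable ?_
        simp only [H, Function.uncurry_def]
        fun_prop
      · simp only [H, Function.uncurry_def, norm_mul, ← Complex.ofReal_mul,
          Complex.norm_exp_ofReal_mul_I, mul_one]
        simp
    rw [← integral_complex_ofReal]
    calc _ = ∫ u, ∫ t, H u t := by
          refine integral_congr_ae ?_
          have : ∀ᵐ u : ℝ, u ≠ y := by simp [ae_iff]
          filter_upwards [this] with u hu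
          have hne : a * (y - u) ≠ 0 := mul_ne_zero ha.ne' (sub_ne_zero.2 hu.symm)
          simp only [H]
          rw [integral_const_mul, integral_tent_mul_cexp hne]
          push_cast
          ring
      _ = ∫ t, ∫ u, H u t := integral_integral_swap hH
      _ = _ := by
          refine integral_congr_ae (.of_forall fun t ↦ ?_)
          have hre : 0 < (δ + a * t * Complex.I : ℂ).re := by simpa using hδ
          simp only
          rw [← hfG _ hre, ← integral_const_mul]
          refine integral_congr_ae (.of_forall fun u ↦ ?_)
          simp only [H]
          push_cast
          have : Complex.exp (-δ * u) * Complex.exp (a * (y - u) * t * Complex.I) =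
              Complex.exp (a * y * t * Complex.I) *
                Complex.exp (-(δ + a * t * Complex.I) * u) := by
            rw [← Complex.exp_add, ← Complex.exp_add]
            ring_nf
          linear_combination (f u : ℂ) * tent t * this
  have hlim (y : ℝ) : ((∫ u, f u * fejerKernel (a * (y - u)) : ℝ) : ℂ) =
      ∫ t : ℝ, (tent t : ℂ) * Complex.exp (a * y * t * Complex.I) * G (a * t * Complex.I) := by
    have hK : Integrable fun u ↦ fejerKernel (a * (y - u)) :=
      (integrable_fejerKernel.comp_mul_left' ha.ne').comp_sub_left y
    have hL : Tendsto (fun δ : ℝ ↦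
        ((∫ u, f u * Real.exp (-δ * u) * fejerKernel (a * (y - u)) : ℝ) : ℂ))
        (nhdsWithin 0 (Set.Ioi 0))
        (nhds ((∫ u, f u * fejerKernel (a * (y - u)) : ℝ) : ℂ)) := by
      refine (Complex.continuous_ofReal.tendsto _).comp ?_
      refine tendsto_integral_filter_of_dominated_convergence
        (fun u ↦ M * fejerKernel (a * (y - u))) ?_ ?_ (hK.const_mul M) ?_
      · have := measurable_fejerKernel
        exact .of_forall fun δ ↦ Measurable.aestronglyMeasurable (by fun_prop)
      · filter_upwards [self_mem_nhdsWithin] with δ hδ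
        refine .of_forall fun u ↦ ?_
        rw [norm_mul, Real.norm_of_nonneg (fejerKernel_nonneg _), Real.norm_eq_abs]
        exact mul_le_mul_of_nonneg_right ((hexp (le_of_lt hδ) u).trans (hM u))
          (fejerKernel_nonneg _)
      · refine .of_forall fun u ↦ Tendsto.mono_left ?_ nhdsWithin_le_nhds
        have : Continuous fun δ : ℝ ↦ f u * Real.exp (-δ * u) * fejerKernel (a * (y - u)) := by
          fun_prop
        simpa using this.tendsto 0
    have hcpt : IsCompact ((fun p : ℝ × ℝ ↦ (p.1 + a * p.2 * Complex.I : ℂ)) ''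
        (Set.Icc 0 1 ×ˢ Set.Icc (-1) 1)) :=
      (isCompact_Icc.prod isCompact_Icc).image (by fun_prop)
    have hsub : ((fun p : ℝ × ℝ ↦ (p.1 + a * p.2 * Complex.I : ℂ)) ''
        (Set.Icc 0 1 ×ˢ Set.Icc (-1) 1)) ⊆ {s | 0 ≤ s.re} := by
      rintro _ ⟨p, hp, rfl⟩
      simpa using hp.1.1
    obtain ⟨C, hC⟩ := hcpt.exists_bound_of_continuousOn (hG.mono hsub)
    have hR : Tendsto (fun δ : ℝ ↦
        ∫ t : ℝ, (tent t : ℂ) * Complex.exp (a * y * t * Complex.I) * G (δ + a * t * Complex.I))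
        (nhdsWithin 0 (Set.Ioi 0))
        (nhds (∫ t : ℝ, (tent t : ℂ) * Complex.exp (a * y * t * Complex.I) *
          G (a * t * Complex.I))) := by
      refine tendsto_integral_filter_of_dominated_convergence (fun t ↦ tent t * C) ?_ ?_
        ((continuous_tent.integrable_of_hasCompactSupport hasCompactSupport_tent).mul_const C) ?_
      · filter_upwards [self_mem_nhdsWithin] with δ hδ
        have hδ' : 0 < δ := hδ
        have := continuous_tent
        have h2 : Continuous fun t : ℝ ↦ G (δ + a * t * Complex.I) :=
          hG.comp_continuous (by fun_prop) fun t ↦ by simpa using hδ'.le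
        refine Continuous.aestronglyMeasurable (Continuous.mul ?_ h2)
        fun_prop
      · filter_upwards [Ioo_mem_nhdsGT (zero_lt_one' ℝ)] with δ hδ
        refine .of_forall fun t ↦ ?_
        have h1 : ‖Complex.exp (a * y * t * Complex.I)‖ = 1 := by
          exact_mod_cast Complex.norm_exp_ofReal_mul_I (a * y * t)
        rw [norm_mul, norm_mul, h1, mul_one, Complex.norm_real,
          Real.norm_of_nonneg (tent_nonneg t)]
        rcases le_or_gt 1 |t| with ht | ht
        · simp [tent_eq_zero ht]
        · refine mul_le_mul_of_nonneg_left (hC _ ⟨(δ, t), ⟨⟨hδ.1.le, hδ.2.le⟩, ?_⟩, rfl⟩)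
            (tent_nonneg t)
          exact abs_le.1 ht.le
      · refine .of_forall fun t ↦ Tendsto.const_mul _ ?_
        have h1 : ContinuousWithinAt G {s | 0 ≤ s.re} ((0 : ℝ) + a * t * Complex.I) :=
          hG _ (by simp)
        have h2 : Continuous fun δ : ℝ ↦ (δ + a * t * Complex.I : ℂ) := by fun_prop
        have h3 := h1.tendsto.comp (tendsto_nhdsWithin_of_tendsto_nhds_of_eventually_within _
          ((h2.tendsto 0).mono_left nhdsWithin_le_nhds) (by
            filter_upwards [self_mem_nhdsWithin] with δ hδ
            simpa using le_of_lt hδ : ∀ᶠ δ : ℝ in nhdsWithin 0 (Set.Ioi 0), _))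
        simpa [Function.comp_def] using h3
    refine tendsto_nhds_unique hL (hR.congr' ?_)
    filter_upwards [self_mem_nhdsWithin] with δ hδ
    exact (hpar hδ y).symm
  have hRL : Tendsto (fun y : ℝ ↦
      ∫ t : ℝ, (tent t : ℂ) * Complex.exp (a * y * t * Complex.I) * G (a * t * Complex.I))
      atTop (nhds 0) := by
    have h1 := Real.tendsto_integral_exp_smul_cocompact
      fun t : ℝ ↦ (tent t : ℂ) * G (a * t * Complex.I)
    have h2 : Tendsto (fun y : ℝ ↦ -(a / (2 * Real.pi)) * y) atTop (cocompact ℝ) := by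
      refine Tendsto.mono_right ?_ atBot_le_cocompact
      exact tendsto_id.const_mul_atTop_of_neg (neg_lt_zero.2 (by positivity))
    refine (h1.comp h2).congr fun y ↦ integral_congr_ae (.of_forall fun t ↦ ?_)
    have hpi : (Real.pi : ℂ) ≠ 0 := by exact_mod_cast Real.pi_ne_zero
    simp only [Circle.smul_def, Real.fourierChar_apply, smul_eq_mul]
    have : ((2 * Real.pi * -(t * (-(a / (2 * Real.pi)) * y)) : ℝ) : ℂ) = a * y * t := by
      push_cast
      field_simp
    rw [this]
    ring
  have h3 := (Complex.continuous_re.tendsto 0).comp (hRL.congr fun y ↦ (hlim y).symm)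
  simpa [Function.comp_def] using h3

lemma tendsto_intervalIntegral_fejerKernel :
    Tendsto (fun h : ℝ ↦ ∫ w in -h⁻¹..h⁻¹, fejerKernel w) (nhdsWithin 0 (Set.Ioi 0))
      (nhds (∫ w, fejerKernel w)) :=
  MeasureTheory.intervalIntegral_tendsto_integral integrable_fejerKernel
    (tendsto_neg_atTop_atBot.comp tendsto_inv_nhdsGT_zero) tendsto_inv_nhdsGT_zero

open MeasureTheory in
/-- A Tauberian theorem for bounded functions `B` such that `B u * exp u` is nondecreasing. -/
theorem tendsto_one_of_tendsto_integral_fejerKernel {B : ℝ → ℝ} (hB : Measurable B) {M : ℝ}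
    (hB0 : ∀ u, 0 ≤ B u) (hM : ∀ u, B u ≤ M)
    (hmono : ∀ u v, u ≤ v → B u * Real.exp (u - v) ≤ B v)
    (hconv : ∀ a : ℝ, 0 < a → Tendsto
      (fun y ↦ ∫ u, (B u - (Set.Ici 0).indicator 1 u) * fejerKernel (a * (y - u))) atTop (nhds 0)) :
    Tendsto B atTop (nhds 1) := by
  set c := ∫ w, fejerKernel w with hc
  have hcpos : 0 < c := integral_fejerKernel_pos
  have hind : Measurable ((Set.Ici (0 : ℝ)).indicator (1 : ℝ → ℝ)) :=
    measurable_one.indicator measurableSet_Ici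
  have hBint (y r : ℝ) : Integrable fun w ↦ B (y - r * w) * fejerKernel w :=
    integrable_fejerKernel.bdd_mul (c := M)
      (Measurable.aestronglyMeasurable (by fun_prop)) (.of_forall fun w ↦ by
      rw [Real.norm_of_nonneg (hB0 _)]; exact hM _)
  have hindint (y r : ℝ) :
      Integrable fun w ↦ (Set.Ici (0 : ℝ)).indicator 1 (y - r * w) * fejerKernel w :=
    integrable_fejerKernel.bdd_mul (c := 1)
      (Measurable.aestronglyMeasurable (by fun_prop)) (.of_forall fun w ↦ by
      by_cases h : y - r * w ∈ Set.Ici (0 : ℝ) <;> simp only [h, Set.indicator_of_mem,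
        Set.indicator_of_notMem, not_false_eq_true] <;> simp)
  have hI {r : ℝ} (hr : 0 < r) :
      Tendsto (fun y ↦ ∫ w, B (y - r * w) * fejerKernel w) atTop (nhds c) := by
    have h1 : Tendsto (fun y ↦ ∫ w, (Set.Ici (0 : ℝ)).indicator 1 (y - r * w) * fejerKernel w)
        atTop (nhds c) := by
      refine tendsto_integral_filter_of_dominated_convergence fejerKernel
        (.of_forall fun y ↦ (hindint y r).1) (.of_forall fun y ↦ .of_forall fun w ↦ ?_)
        integrable_fejerKernel (.of_forall fun w ↦ ?_)
      · by_cases h : y - r * w ∈ Set.Ici (0 : ℝ) <;> simp only [h, Set.indicator_of_mem,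
          Set.indicator_of_notMem, not_false_eq_true] <;>
          simp [abs_of_nonneg, fejerKernel_nonneg]
      · refine tendsto_const_nhds.congr' ?_
        filter_upwards [eventually_ge_atTop (r * w)] with y hy
        simp [hy]
    have h2 : Tendsto (fun y ↦ ∫ w, (B (y - r * w) - (Set.Ici (0 : ℝ)).indicator 1 (y - r * w)) *
        fejerKernel w) atTop (nhds 0) := by
      have h3 := (hconv r⁻¹ (inv_pos.2 hr)).const_mul r⁻¹
      rw [mul_zero] at h3
      refine h3.congr fun y ↦ ?_
      rw [← integral_sub_left_eq_self (μ := volume) _ y]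
      have h4 := Measure.integral_comp_mul_left
        (fun u ↦ (B (y - u) - (Set.Ici (0 : ℝ)).indicator 1 (y - u)) * fejerKernel (r⁻¹ * u)) r
      rw [abs_of_pos (inv_pos.2 hr), smul_eq_mul] at h4
      simp only [sub_sub_cancel]
      rw [← h4]
      simp [hr.ne']
    refine (zero_add c ▸ h2.add h1).congr fun y ↦ ?_
    rw [← integral_add _ (hindint y r)]
    · simp [sub_mul]
    · simp only [sub_mul]
      exact (hBint y r).sub (hindint y r)
  have hexp : Tendsto Real.exp (nhdsWithin 0 (Set.Ioi 0)) (nhds 1) := by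
    simpa using (Real.continuous_exp.tendsto 0).mono_left nhdsWithin_le_nhds
  have hJ := tendsto_intervalIntegral_fejerKernel
  rw [← hc] at hJ
  set J : ℝ → ℝ := fun h ↦ ∫ w in -h⁻¹..h⁻¹, fejerKernel w with hJdef
  have hJset {h : ℝ} (hh : 0 < h) : J h = ∫ w in Set.Ioc (-h⁻¹) h⁻¹, fejerKernel w :=
    intervalIntegral.integral_of_le (by linarith [inv_pos.2 hh])
  have hmem {h w : ℝ} (hh : 0 < h) (hw : w ∈ Set.Ioc (-h⁻¹) h⁻¹) :
      |h ^ 2 / 2 * w| ≤ h / 2 := by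
    have h1 : |w| ≤ h⁻¹ := abs_le.2 ⟨hw.1.le, hw.2⟩
    rw [abs_mul, abs_of_pos (by positivity)]
    calc h ^ 2 / 2 * |w| ≤ h ^ 2 / 2 * h⁻¹ := by gcongr
      _ = h / 2 := by field_simp
  have hupper {h : ℝ} (hh : 0 < h) (y : ℝ) :
      B y * Real.exp (-h) * J h ≤ ∫ w, B (y + h / 2 - h ^ 2 / 2 * w) * fejerKernel w := by
    rw [hJset hh, ← integral_const_mul]
    refine (setIntegral_mono_on (integrable_fejerKernel.integrableOn.const_mul _)
      (hBint _ _).integrableOn measurableSet_Ioc fun w hw ↦ ?_).trans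
      (setIntegral_le_integral (hBint _ _) (.of_forall fun w ↦
        mul_nonneg (hB0 _) (fejerKernel_nonneg w)))
    have h1 := abs_le.1 (hmem hh hw)
    refine mul_le_mul_of_nonneg_right (le_trans ?_ (hmono y _ (by linarith [h1.2])))
      (fejerKernel_nonneg w)
    exact mul_le_mul_of_nonneg_left (Real.exp_le_exp.2 (by linarith [h1.1])) (hB0 y)
  have hlower {h : ℝ} (hh : 0 < h) (y : ℝ) :
      (∫ w, B (y - h / 2 - h ^ 2 / 2 * w) * fejerKernel w) ≤
        B y * Real.exp h * J h + M * (c - J h) := by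
    rw [hJset hh, hc, ← integral_add_compl (measurableSet_Ioc (a := -h⁻¹) (b := h⁻¹)) (hBint _ _),
      ← integral_add_compl (measurableSet_Ioc (a := -h⁻¹) (b := h⁻¹)) integrable_fejerKernel,
      add_sub_cancel_left, ← integral_const_mul, ← integral_const_mul]
    refine add_le_add (setIntegral_mono_on (hBint _ _).integrableOn
      (integrable_fejerKernel.integrableOn.const_mul _) measurableSet_Ioc fun w hw ↦ ?_)
      (setIntegral_mono (hBint _ _).integrableOn
      (integrable_fejerKernel.integrableOn.const_mul _) fun w ↦
        mul_le_mul_of_nonneg_right (hM _) (fejerKernel_nonneg w))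
    have h1 := abs_le.1 (hmem hh hw)
    refine mul_le_mul_of_nonneg_right ?_ (fejerKernel_nonneg w)
    have h2 := hmono (y - h / 2 - h ^ 2 / 2 * w) y (by linarith [h1.1])
    have h3 : Real.exp (-h) ≤ Real.exp (y - h / 2 - h ^ 2 / 2 * w - y) :=
      Real.exp_le_exp.2 (by linarith [h1.2])
    rw [← div_le_iff₀ (Real.exp_pos h), div_eq_mul_inv, ← Real.exp_neg]
    exact (mul_le_mul_of_nonneg_left h3 (hB0 _)).trans h2
  have hshift (d : ℝ) {r : ℝ} (hr : 0 < r) :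
      Tendsto (fun y ↦ ∫ w, B (y + d - r * w) * fejerKernel w) atTop (nhds c) :=
    (hI hr).comp (tendsto_atTop_add_const_right _ d tendsto_id)
  refine tendsto_order.2 ⟨fun b hb ↦ ?_, fun b hb ↦ ?_⟩
  · have h1 : Tendsto (fun h ↦ (c - M * (c - J h)) / (Real.exp h * J h))
        (nhdsWithin 0 (Set.Ioi 0)) (nhds 1) := by
      have := (tendsto_const_nhds (x := c)).sub ((hJ.const_sub c).const_mul M) |>.div
        (hexp.mul hJ) (by simpa using hcpos.ne')
      simpa [hcpos.ne', Pi.div_def] using this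
    obtain ⟨h, hbh, hJh, hh⟩ := ((h1.eventually_const_lt hb).and
      ((hJ.eventually_const_lt hcpos).and self_mem_nhdsWithin)).exists
    have hh : 0 < h := hh
    have h2 := ((hshift (-(h / 2)) (by positivity : 0 < h ^ 2 / 2)).sub_const
      (M * (c - J h))).div_const (Real.exp h * J h)
    filter_upwards [h2.eventually_const_lt hbh] with y hy
    refine hy.trans_le ?_
    rw [div_le_iff₀ (by positivity), ← mul_assoc]
    simpa only [sub_le_iff_le_add, sub_eq_add_neg y] using hlower hh y
  · have h1 : Tendsto (fun h ↦ c / (Real.exp (-h) * J h))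
        (nhdsWithin 0 (Set.Ioi 0)) (nhds 1) := by
      have h2 : Tendsto (fun h ↦ Real.exp (-h)) (nhdsWithin 0 (Set.Ioi 0)) (nhds 1) := by
        simpa [Real.exp_neg] using hexp.inv₀ one_ne_zero
      have := (tendsto_const_nhds (x := c)).div (h2.mul hJ) (by simpa using hcpos.ne')
      simpa [hcpos.ne', Pi.div_def] using this
    obtain ⟨h, hbh, hJh, hh⟩ := ((h1.eventually_lt_const hb).and
      ((hJ.eventually_const_lt hcpos).and self_mem_nhdsWithin)).exists
    have hh : 0 < h := hh
    have h2 := (hshift (h / 2) (by positivity : 0 < h ^ 2 / 2)).div_const (Real.exp (-h) * J h)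
    filter_upwards [h2.eventually_lt_const hbh] with y hy
    refine lt_of_le_of_lt ?_ hy
    rw [le_div_iff₀ (by positivity), ← mul_assoc]
    exact hupper hh y

lemma exp_image_Ioi_zero : Real.exp '' Set.Ioi 0 = Set.Ioi 1 := by
  ext x
  refine ⟨?_, fun hx ↦ ⟨Real.log x, Real.log_pos hx, Real.exp_log (zero_lt_one.trans hx)⟩⟩
  rintro ⟨u, hu, rfl⟩
  exact Real.one_lt_exp_iff.2 hu

lemma psi_exp_mul_exp_neg_nonneg (u : ℝ) : 0 ≤ Chebyshev.psi (Real.exp u) * Real.exp (-u) :=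
  mul_nonneg (Chebyshev.psi_nonneg _) (Real.exp_pos _).le

lemma psi_exp_mul_exp_neg_le (u : ℝ) :
    Chebyshev.psi (Real.exp u) * Real.exp (-u) ≤ Real.log 4 + 4 := by
  rw [Real.exp_neg, ← div_eq_mul_inv, div_le_iff₀ (Real.exp_pos u)]
  exact Chebyshev.psi_le_const_mul_self (Real.exp_pos u).le

lemma psi_exp_eq_zero {u : ℝ} (hu : u ≤ 0) : Chebyshev.psi (Real.exp u) = 0 :=
  Chebyshev.psi_eq_zero_of_le_one (Real.exp_le_one_iff.2 hu)

lemma measurable_psi_exp_mul_exp_neg :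
    Measurable fun u ↦ Chebyshev.psi (Real.exp u) * Real.exp (-u) := by
  have := Chebyshev.psi_mono.measurable
  fun_prop

open MeasureTheory ArithmeticFunction in
lemma LSeries_vonMangoldt_eq_mul_integral_exp {s : ℂ} (hs : 0 < s.re) :
    LSeries (fun n ↦ (vonMangoldt n : ℂ)) (s + 1) = (s + 1) * ∫ u in Set.Ioi (0 : ℝ),
      ((Chebyshev.psi (Real.exp u) * Real.exp (-u) : ℝ) : ℂ) * Complex.exp (-s * u) := by
  have hO : (fun n : ℕ ↦ ∑ k ∈ Finset.Icc 1 n, vonMangoldt k) =O[atTop]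
      fun n ↦ (n : ℝ) ^ (1 : ℝ) := by
    refine Asymptotics.IsBigO.of_bound (Real.log 4 + 4) (.of_forall fun n ↦ ?_)
    have h := Chebyshev.psi_le_const_mul_self (Nat.cast_nonneg n)
    have h0 := Chebyshev.psi_nonneg n
    rw [Chebyshev.psi, Nat.floor_natCast] at h h0
    change 0 ≤ ∑ k ∈ Finset.Icc 1 n, vonMangoldt k at h0
    rw [Real.norm_of_nonneg h0, Real.rpow_one, Real.norm_of_nonneg (Nat.cast_nonneg n)]
    exact h
  rw [LSeries_eq_mul_integral_of_nonneg _ zero_le_one (by simpa using hs) hO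
    fun n ↦ vonMangoldt_nonneg, ← exp_image_Ioi_zero,
    integral_image_eq_integral_abs_deriv_smul measurableSet_Ioi
      (fun u _ ↦ (Real.hasDerivAt_exp u).hasDerivWithinAt) Real.exp_injective.injOn]
  congr 1
  refine integral_congr_ae (.of_forall fun u ↦ ?_)
  have hpsi : (∑ k ∈ Finset.Icc 1 ⌊Real.exp u⌋₊, (vonMangoldt k : ℂ)) =
      (Chebyshev.psi (Real.exp u) : ℂ) := by
    rw [Chebyshev.psi]
    push_cast
    rfl
  have hpow : ((Real.exp u : ℝ) : ℂ) ^ (-(s + 1 + 1)) = Complex.exp (-(s + 1 + 1) * u) := by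
    rw [Complex.cpow_def_of_ne_zero (by simp), ← Complex.ofReal_log (Real.exp_pos u).le,
      Real.log_exp, mul_comm]
  have hmul : Complex.exp u * Complex.exp (-(s + 1 + 1) * u) =
      Complex.exp (-u) * Complex.exp (-s * u) := by
    rw [← Complex.exp_add, ← Complex.exp_add]
    ring_nf
  simp only
  rw [hpsi, hpow, abs_of_pos (Real.exp_pos u), Complex.real_smul]
  push_cast
  linear_combination (Chebyshev.psi (Real.exp u) : ℂ) * hmul

open MeasureTheory ArithmeticFunction in
/-- The Laplace transform of `ψ(exp u) / exp u - 1` on `[0, ∞)`. -/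
lemma integral_psi_exp_sub_one_mul_cexp {s : ℂ} (hs : 0 < s.re) :
    ∫ u : ℝ, ((Chebyshev.psi (Real.exp u) * Real.exp (-u) - (Set.Ici 0).indicator 1 u : ℝ) : ℂ) *
        Complex.exp (-s * u) =
      (vonMangoldt.LFunctionResidueClassAux (1 : ZMod 1) (s + 1) - 1) / (s + 1) := by
  have hs0 : s ≠ 0 := fun h ↦ by simp [h] at hs
  have hs1 : s + 1 ≠ 0 := fun h ↦ by
    have := congrArg Complex.re h
    simp at this
    linarith
  have hexp : IntegrableOn (fun u : ℝ ↦ Complex.exp (-s * u)) (Set.Ioi 0) :=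
    integrableOn_exp_mul_complex_Ioi (by simpa using hs) 0
  have hB : IntegrableOn (fun u : ℝ ↦ ((Chebyshev.psi (Real.exp u) * Real.exp (-u) : ℝ) : ℂ) *
      Complex.exp (-s * u)) (Set.Ioi 0) := by
    refine Integrable.bdd_mul (c := Real.log 4 + 4) hexp
      (Complex.measurable_ofReal.comp measurable_psi_exp_mul_exp_neg).aestronglyMeasurable
      (.of_forall fun u ↦ ?_)
    rw [Complex.norm_real, Real.norm_of_nonneg (psi_exp_mul_exp_neg_nonneg u)]
    exact psi_exp_mul_exp_neg_le u
  have hclass : (fun n ↦ (vonMangoldt.residueClass (1 : ZMod 1) n : ℂ)) =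
      fun n ↦ (vonMangoldt n : ℂ) := by
    ext n
    rw [vonMangoldt.residueClass, Set.indicator_of_mem
      (show n ∈ {n : ℕ | (n : ZMod 1) = 1} from Subsingleton.elim _ _)]
  have hL := vonMangoldt.eqOn_LFunctionResidueClassAux (isUnit_one (M := ZMod 1))
    (show 1 < (s + 1).re by simpa using hs)
  simp only [hclass] at hL
  rw [hL, LSeries_vonMangoldt_eq_mul_integral_exp hs]
  have hsplit : ∫ u : ℝ, ((Chebyshev.psi (Real.exp u) * Real.exp (-u) -
      (Set.Ici 0).indicator 1 u : ℝ) : ℂ) * Complex.exp (-s * u) =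
      ∫ u in Set.Ioi (0 : ℝ), (((Chebyshev.psi (Real.exp u) * Real.exp (-u) : ℝ) : ℂ) *
        Complex.exp (-s * u) - Complex.exp (-s * u)) := by
    rw [← integral_Ici_eq_integral_Ioi, ← integral_indicator measurableSet_Ici]
    refine integral_congr_ae (.of_forall fun u ↦ ?_)
    rcases lt_or_ge u 0 with hu | hu
    · simp [hu, psi_exp_eq_zero hu.le]
    · simp [hu, sub_mul]
  rw [hsplit, integral_sub hB hexp, integral_exp_mul_complex_Ioi (by simpa using hs)]
  simp only [Nat.totient_one, Nat.cast_one, inv_one, add_sub_cancel_right, Complex.ofReal_zero,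
    mul_zero, Complex.exp_zero]
  field_simp
  ring

open ArithmeticFunction in
/-- The Prime Number Theorem for the Chebyshev function `ψ`, in exponential coordinates. -/
lemma tendsto_psi_exp_mul_exp_neg :
    Tendsto (fun u ↦ Chebyshev.psi (Real.exp u) * Real.exp (-u)) atTop (nhds 1) := by
  refine tendsto_one_of_tendsto_integral_fejerKernel measurable_psi_exp_mul_exp_neg
    psi_exp_mul_exp_neg_nonneg psi_exp_mul_exp_neg_le (fun u v huv ↦ ?_) fun a ha ↦ ?_
  · rw [mul_assoc, ← Real.exp_add, show -u + (u - v) = -v by ring]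
    exact mul_le_mul_of_nonneg_right (Chebyshev.psi_mono (Real.exp_le_exp.2 huv))
      (Real.exp_pos _).le
  · refine tendsto_integral_mul_fejerKernel (M := Real.log 4 + 4 + 1)
      (measurable_psi_exp_mul_exp_neg.sub (measurable_one.indicator measurableSet_Ici))
      (fun u ↦ ?_) (fun u hu ↦ ?_) (G := fun s ↦
        (vonMangoldt.LFunctionResidueClassAux (1 : ZMod 1) (s + 1) - 1) / (s + 1))
      ?_ (fun s hs ↦ integral_psi_exp_sub_one_mul_cexp hs) ha
    · have h1 := psi_exp_mul_exp_neg_nonneg u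
      have h2 := psi_exp_mul_exp_neg_le u
      have h3 : 0 ≤ (Set.Ici (0 : ℝ)).indicator (1 : ℝ → ℝ) u :=
        Set.indicator_nonneg (fun _ _ ↦ zero_le_one) u
      have h4 : (Set.Ici (0 : ℝ)).indicator (1 : ℝ → ℝ) u ≤ 1 :=
        Set.indicator_le_self' (fun _ _ ↦ zero_le_one) u
      change |Chebyshev.psi (Real.exp u) * Real.exp (-u) - (Set.Ici 0).indicator 1 u| ≤ _
      rw [abs_le]
      constructor <;> linarith
    · simp [hu, psi_exp_eq_zero hu.le]
    · have h1 := vonMangoldt.continuousOn_LFunctionResidueClassAux (1 : ZMod 1)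
      have h2 : ContinuousOn (fun s : ℂ ↦ s + 1) {s | 0 ≤ s.re} := by fun_prop
      refine ((h1.comp h2 fun s hs ↦ ?_).sub continuousOn_const).div h2 fun s hs h ↦ ?_
      · simpa using hs
      · have h3 := congrArg Complex.re h
        simp only [Complex.add_re, Complex.one_re, Complex.zero_re] at h3
        have h4 : 0 ≤ s.re := hs
        linarith

/-- The Prime Number Theorem for the Chebyshev function `ψ`. -/
theorem tendsto_psi_div : Tendsto (fun x ↦ Chebyshev.psi x / x) atTop (nhds 1) := by
  refine (tendsto_psi_exp_mul_exp_neg.comp Real.tendsto_log_atTop).congr' ?_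
  filter_upwards [eventually_gt_atTop 0] with x hx
  simp [Real.exp_neg, Real.exp_log hx, div_eq_mul_inv]

/-- The Prime Number Theorem for the Chebyshev function `θ`. -/
theorem tendsto_theta_div : Tendsto (fun x ↦ Chebyshev.theta x / x) atTop (nhds 1) := by
  have h1 : (Chebyshev.psi - Chebyshev.theta) =o[atTop] (fun x : ℝ ↦ x) := by
    refine Chebyshev.isBigO_psi_sub_theta_sqrt.trans_isLittleO ?_
    refine (Asymptotics.isLittleO_iff_tendsto' ?_).2 ?_
    · filter_upwards [eventually_gt_atTop 0] with x hx h using absurd h hx.ne'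
    · simp only [Real.sqrt_div_self]
      exact Real.tendsto_sqrt_atTop.inv_tendsto_atTop
  have h2 := tendsto_psi_div.sub h1.tendsto_div_nhds_zero
  rw [sub_zero] at h2
  refine h2.congr fun x ↦ ?_
  rw [← sub_div, Pi.sub_apply, sub_sub_cancel]

/-- **Prime Number Theorem**: `π(x) ~ x / log x` as `x → ∞`, i.e.
`lim_{x→∞} π(x)·log(x)/x = 1`, where `π(x)` is the number of primes `≤ x`. -/
theorem prime_number_theorem :
    Tendsto (fun x : ℝ => (Nat.primeCounting ⌊x⌋₊ : ℝ) * Real.log x / x)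
      atTop (nhds 1) := by
  have h1 : (fun x : ℝ ↦ (Nat.primeCounting ⌊x⌋₊ : ℝ) - Chebyshev.theta x / Real.log x)
      =o[atTop] (fun x ↦ x / Real.log x) := by
    refine Chebyshev.primeCounting_sub_theta_div_log_isBigO.trans_isLittleO ?_
    have h : (fun x : ℝ ↦ (Real.log x)⁻¹) =o[atTop] (fun _ ↦ (1 : ℝ)) :=
      (Asymptotics.isLittleO_one_iff ℝ).2 Real.tendsto_log_atTop.inv_tendsto_atTop
    refine ((Asymptotics.isBigO_refl (fun x ↦ x / Real.log x) atTop).mul_isLittleO h).congr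
      (fun x ↦ ?_) fun x ↦ mul_one _
    rw [div_mul_eq_mul_div, pow_two, ← div_div, div_eq_mul_inv x]
  have h2 := tendsto_theta_div.add h1.tendsto_div_nhds_zero
  rw [add_zero] at h2
  refine h2.congr' ?_
  filter_upwards [eventually_gt_atTop 1] with x hx
  have hlog := Real.log_pos hx
  have hx0 : 0 < x := zero_lt_one.trans hx
  field_simp
  ring
end

section
/- For every A > 0 there exists a constant M > 0 (depending on A) such that |ζ(s)| ≤ M·log t and |ζ′(s)| ≤ M·(log t)² for every s = σ + it with σ ≥ 1/2, σ > 1 − A/log t, and t ≥ e. -/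
open Complex

lemma norm_cpow_neg_sub_cpow_neg_le {a b δ : ℝ} {s : ℂ} (ha : 1 ≤ a) (hab : a ≤ b)
    (hδ : 0 < δ) (hs : δ ≤ s.re) :
    ‖(b : ℂ) ^ (-s) - (a : ℂ) ^ (-s)‖ ≤ ‖s‖ / δ * (a ^ (-δ) - b ^ (-δ)) := by
  have hs0 : s ≠ 0 := by
    rintro rfl
    simp only [zero_re] at hs
    linarith
  have h0 : (0 : ℝ) ∉ Set.uIcc a b := by
    rw [Set.uIcc_of_le hab]
    rintro ⟨h, -⟩
    linarith
  have hI := integral_cpow (a := a) (b := b) (r := -s - 1)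
    (Or.inr ⟨fun h ↦ hs0 (by linear_combination -h), h0⟩)
  have hR := integral_rpow (a := a) (b := b) (r := -δ - 1)
    (Or.inr ⟨fun h ↦ hδ.ne' (by linarith), h0⟩)
  rw [sub_add_cancel] at hI hR
  have hle : ‖∫ x : ℝ in a..b, (x : ℂ) ^ (-s - 1)‖ ≤ ∫ x in a..b, x ^ (-δ - 1) := by
    refine intervalIntegral.norm_integral_le_of_norm_le hab
      (Filter.Eventually.of_forall fun x hx ↦ ?_) ?_
    · rw [norm_cpow_eq_rpow_re_of_pos (by linarith [hx.1])]
      apply Real.rpow_le_rpow_of_exponent_le (by linarith [hx.1])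
      simp only [sub_re, neg_re, one_re]
      linarith
    · exact intervalIntegral.intervalIntegrable_rpow (Or.inr h0)
  have hEq : (b : ℂ) ^ (-s) - (a : ℂ) ^ (-s) =
      -s * ∫ x : ℝ in a..b, (x : ℂ) ^ (-s - 1) := by
    rw [hI]
    field_simp
  rw [hEq, norm_mul, norm_neg]
  calc _ ≤ ‖s‖ * ∫ x in a..b, x ^ (-δ - 1) := by gcongr
    _ = _ := by
      rw [hR]
      field_simp
      ring

/-- The truncated Dirichlet series of `ζ` at `N` terms, corrected by the integral
of `x ^ (-s)` over the tail. -/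
noncomputable def zetaApprox (N : ℕ) (s : ℂ) : ℂ :=
  ∑ k ∈ Finset.range N, ((k + 1 : ℕ) : ℂ) ^ (-s) + (N : ℂ) ^ (1 - s) / (s - 1)

lemma norm_zetaApprox_succ_sub_le {N : ℕ} {δ : ℝ} {s : ℂ} (hN : 1 ≤ N) (hδ : 0 < δ)
    (hs : δ ≤ s.re) (hs1 : s ≠ 1) :
    ‖zetaApprox (N + 1) s - zetaApprox N s‖ ≤
      ‖s‖ / δ * ((N : ℝ) ^ (-δ) - ((N + 1 : ℕ) : ℝ) ^ (-δ)) := by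
  have hN' : (1 : ℝ) ≤ N := by exact_mod_cast hN
  have hs' : s - 1 ≠ 0 := sub_ne_zero.mpr hs1
  have hs'' : 1 - s ≠ 0 := sub_ne_zero.mpr hs1.symm
  set b : ℝ := ((N + 1 : ℕ) : ℝ) with hb
  have hbN : b = N + 1 := by simp [hb]
  let g : ℝ → ℂ := fun x ↦ x * (b : ℂ) ^ (-s) - (x : ℂ) ^ (-s + 1) / (-s + 1)
  have hg : ∀ x ∈ Set.Icc (N : ℝ) b,
      HasDerivWithinAt g ((b : ℂ) ^ (-s) - (x : ℂ) ^ (-s)) (Set.Icc (N : ℝ) b) x := by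
    intro x hx
    have h1 := (hasDerivAt_id x).ofReal_comp.mul_const ((b : ℂ) ^ (-s))
    have h2 := hasDerivAt_ofReal_cpow_const' (x := x) (by linarith [hx.1] : 0 < x).ne'
      (r := -s) (fun h ↦ hs' (by linear_combination -h))
    rw [ofReal_one, one_mul] at h1
    exact (h1.sub h2).hasDerivWithinAt
  have hbound : ∀ x ∈ Set.Icc (N : ℝ) b, ‖(b : ℂ) ^ (-s) - (x : ℂ) ^ (-s)‖ ≤
      ‖s‖ / δ * ((N : ℝ) ^ (-δ) - b ^ (-δ)) := by
    intro x hx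
    refine (norm_cpow_neg_sub_cpow_neg_le (by linarith [hx.1]) hx.2 hδ hs).trans ?_
    gcongr ?_ * (?_ - _)
    exact Real.rpow_le_rpow_of_nonpos (by linarith) hx.1 (by linarith)
  have hmv := (convex_Icc (N : ℝ) b).norm_image_sub_le_of_norm_hasDerivWithin_le hg hbound
    (Set.left_mem_Icc.mpr (by linarith)) (Set.right_mem_Icc.mpr (by linarith))
  have hEq : zetaApprox (N + 1) s - zetaApprox N s = g b - g N := by
    simp only [zetaApprox, Finset.sum_range_succ, g, hb]
    push_cast
    rw [show -s + 1 = 1 - s by ring, show s - 1 = -(1 - s) by ring]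
    field_simp
    ring
  rw [hEq]
  simpa [hbN] using hmv

lemma norm_zetaApprox_sub_le {N M : ℕ} {δ : ℝ} {s : ℂ} (hN : 1 ≤ N) (hNM : N ≤ M) (hδ : 0 < δ)
    (hs : δ ≤ s.re) (hs1 : s ≠ 1) :
    ‖zetaApprox M s - zetaApprox N s‖ ≤ ‖s‖ / δ * ((N : ℝ) ^ (-δ) - (M : ℝ) ^ (-δ)) := by
  induction M, hNM using Nat.le_induction with
  | base => simp
  | succ M hM ih =>
    have h := norm_zetaApprox_succ_sub_le (hN.trans hM) hδ hs hs1
    have h' := norm_add_le (zetaApprox (M + 1) s - zetaApprox M s)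
      (zetaApprox M s - zetaApprox N s)
    rw [sub_add_sub_cancel] at h'
    linarith

lemma differentiableAt_zetaApprox {N : ℕ} {s : ℂ} (hN : 1 ≤ N) (hs : s ≠ 1) :
    DifferentiableAt ℂ (zetaApprox N) s := by
  have hN0 : (N : ℂ) ≠ 0 := by exact_mod_cast (by lia : N ≠ 0)
  unfold zetaApprox
  refine DifferentiableAt.add (DifferentiableAt.fun_sum fun k _ ↦ ?_) (DifferentiableAt.div ?_ ?_ ?_)
  · exact DifferentiableAt.const_cpow (by fun_prop) (Or.inl (by exact_mod_cast k.succ_ne_zero))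
  · exact DifferentiableAt.const_cpow (by fun_prop) (Or.inl hN0)
  · fun_prop
  · exact sub_ne_zero.mpr hs

lemma tendsto_zetaApprox_of_one_lt_re {s : ℂ} (hs : 1 < s.re) :
    Filter.Tendsto (fun N ↦ zetaApprox N s) Filter.atTop (nhds (riemannZeta s)) := by
  have hsum : Summable fun n : ℕ ↦ 1 / ((n + 1 : ℕ) : ℂ) ^ s :=
    (summable_nat_add_iff 1).mpr (Complex.summable_one_div_nat_cpow.mpr hs)
  have h1 := hsum.hasSum.tendsto_sum_nat
  have h2 : Filter.Tendsto (fun N : ℕ ↦ (N : ℂ) ^ (1 - s)) Filter.atTop (nhds 0) := by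
    rw [tendsto_zero_iff_norm_tendsto_zero]
    have h := (tendsto_rpow_neg_atTop (sub_pos.mpr hs)).comp
      (tendsto_natCast_atTop_atTop (R := ℝ))
    refine h.congr' ?_
    filter_upwards [Filter.eventually_gt_atTop 0] with N hN
    have := norm_cpow_eq_rpow_re_of_pos (x := N) (by exact_mod_cast hN) (1 - s)
    simp only [ofReal_natCast] at this
    rw [this]
    simp
  have h := h1.add (h2.div_const (s - 1))
  rw [zero_div, add_zero] at h
  rw [zeta_eq_tsum_one_div_nat_add_one_cpow hs]
  simpa [zetaApprox, cpow_neg] using h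

lemma tendsto_zetaApprox {s : ℂ} (hs : 0 < s.re) (hs' : 0 < s.im) :
    Filter.Tendsto (fun N ↦ zetaApprox N s) Filter.atTop (nhds (riemannZeta s)) := by
  obtain ⟨δ, hδ, hδs, hδ1⟩ : ∃ δ : ℝ, 0 < δ ∧ δ < s.re ∧ δ < 1 := by
    obtain ⟨δ, h, h'⟩ := exists_between (lt_min hs one_pos)
    exact ⟨δ, h, (lt_min_iff.mp h').1, (lt_min_iff.mp h').2⟩
  set R : ℝ := ‖s‖ + 3
  let U : Set ℂ := {z | δ < z.re} ∩ {z | 0 < z.im} ∩ Metric.ball 0 R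
  have hUo : IsOpen U := ((isOpen_lt continuous_const continuous_re).inter
    (isOpen_lt continuous_const continuous_im)).inter Metric.isOpen_ball
  have hUc : Convex ℝ U := ((convex_halfSpace_re_gt δ).inter
    (convex_halfSpace_im_gt 0)).inter (convex_ball 0 R)
  have hU1 : ∀ z ∈ U, z ≠ 1 := by
    rintro z hz rfl
    simpa using hz.1.2
  let e : ℕ → ℂ → ℂ := fun n z ↦ zetaApprox (n + 2) z - zetaApprox (n + 1) z
  let u : ℕ → ℝ := fun n ↦ R / δ * (((n + 1 : ℕ) : ℝ) ^ (-δ) - ((n + 2 : ℕ) : ℝ) ^ (-δ))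
  have hu0 : ∀ n : ℕ, ((n + 2 : ℕ) : ℝ) ^ (-δ) ≤ ((n + 1 : ℕ) : ℝ) ^ (-δ) := fun n ↦
    Real.rpow_le_rpow_of_nonpos (by positivity) (by push_cast; linarith) (by linarith)
  have hu : Summable u := by
    refine Summable.mul_left _ (summable_of_sum_range_le (c := 1)
      (fun n ↦ sub_nonneg.mpr (hu0 n)) fun n ↦ ?_)
    rw [Finset.sum_range_sub' (fun n : ℕ ↦ ((n + 1 : ℕ) : ℝ) ^ (-δ))]
    have : 0 ≤ ((n + 1 : ℕ) : ℝ) ^ (-δ) := by positivity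
    simpa using this
  have heu : ∀ n z, z ∈ U → ‖e n z‖ ≤ u n := by
    intro n z hz
    refine (norm_zetaApprox_succ_sub_le n.succ_pos hδ (le_of_lt hz.1.1) (hU1 z hz)).trans ?_
    have hzR : ‖z‖ ≤ R := le_of_lt (by simpa using hz.2)
    have := sub_nonneg.mpr (hu0 n)
    exact mul_le_mul_of_nonneg_right (by gcongr) this
  have hed : ∀ n, DifferentiableOn ℂ (e n) U := fun n z hz ↦
    ((differentiableAt_zetaApprox (by lia) (hU1 z hz)).sub
      (differentiableAt_zetaApprox (by lia) (hU1 z hz))).differentiableWithinAt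
  let F : ℂ → ℂ := fun z ↦ zetaApprox 1 z + ∑' n, e n z
  have hF : DifferentiableOn ℂ F U := DifferentiableOn.add
    (fun z hz ↦ (differentiableAt_zetaApprox le_rfl (hU1 z hz)).differentiableWithinAt)
    (differentiableOn_tsum_of_summable_norm hu hed hUo heu)
  have hFlim : ∀ z ∈ U, Filter.Tendsto (fun N ↦ zetaApprox N z) Filter.atTop (nhds (F z)) := by
    intro z hz
    have hsum : Summable fun n ↦ e n z := .of_norm_bounded hu fun n ↦ heu n z hz
    have h := hsum.hasSum.tendsto_sum_nat.const_add (zetaApprox 1 z)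
    rw [← Filter.tendsto_add_atTop_iff_nat 1]
    refine h.congr fun n ↦ ?_
    rw [Finset.sum_range_sub (fun n ↦ zetaApprox (n + 1) z)]
    simp
  have hζ : DifferentiableOn ℂ riemannZeta U := fun z hz ↦
    (differentiableAt_riemannZeta (hU1 z hz)).differentiableWithinAt
  have hmem : (2 + I : ℂ) ∈ U := by
    refine ⟨⟨?_, ?_⟩, ?_⟩
    · simp
      linarith
    · simp
    · have h := norm_add_le (2 : ℂ) I
      have hs0 : 0 < ‖s‖ := norm_pos_iff.mpr (by rintro rfl; simp at hs)
      simp only [norm_ofNat, norm_I] at h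
      simp only [mem_ball_zero_iff, R]
      linarith
  have hev : F =ᶠ[nhds (2 + I)] riemannZeta := by
    filter_upwards [hUo.mem_nhds hmem,
      (isOpen_lt continuous_const continuous_re).mem_nhds
        (show (2 + I : ℂ) ∈ {z : ℂ | 1 < z.re} by simp)] with z hz hz1
    exact tendsto_nhds_unique (hFlim z hz) (tendsto_zetaApprox_of_one_lt_re hz1)
  have hsU : s ∈ U := ⟨⟨hδs, hs'⟩, by simp [R]⟩
  have := (hF.analyticOnNhd hUo).eqOn_of_preconnected_of_eventuallyEq (hζ.analyticOnNhd hUo)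
    hUc.isPreconnected hmem hev hsU
  rw [← this]
  exact hFlim s hsU

lemma norm_riemannZeta_sub_zetaApprox_le {N : ℕ} {s : ℂ} (hN : 1 ≤ N) (hs : 0 < s.re)
    (hs' : 0 < s.im) :
    ‖riemannZeta s - zetaApprox N s‖ ≤ ‖s‖ / s.re * (N : ℝ) ^ (-s.re) := by
  refine le_of_tendsto ((tendsto_zetaApprox hs hs').sub_const _).norm ?_
  filter_upwards [Filter.eventually_ge_atTop N] with M hM
  refine (norm_zetaApprox_sub_le hN hM hs le_rfl (by rintro rfl; simp at hs')).trans ?_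
  gcongr
  exact sub_le_self _ (by positivity)

lemma norm_riemannZeta_le_of_rpow_le {N : ℕ} {s : ℂ} {E : ℝ} (hN : 1 ≤ N) (hs : 1 / 4 ≤ s.re)
    (hs' : 1 ≤ s.im) (hsN : s.im ≤ 3 * N) (hE : 1 ≤ E) (hNE : (N : ℝ) ^ (1 - s.re) ≤ E) :
    ‖riemannZeta s‖ ≤ E * (15 + Real.log N) := by
  have hN' : (1 : ℝ) ≤ N := by exact_mod_cast hN
  have hnorm (n : ℕ) (hn : 1 ≤ n) (w : ℂ) : ‖(n : ℂ) ^ w‖ = (n : ℝ) ^ w.re := by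
    simpa using norm_cpow_eq_rpow_re_of_pos (x := n) (by exact_mod_cast hn) w
  have hsplit (n : ℕ) (hn : 1 ≤ n) :
      (n : ℝ) ^ (-s.re) = (n : ℝ) ^ (1 - s.re) * (n : ℝ)⁻¹ := by
    have hn0 : (0 : ℝ) < n := by exact_mod_cast hn
    rw [← Real.rpow_neg_one, ← Real.rpow_add hn0]
    ring_nf
  have hpow (n : ℕ) (hn : 1 ≤ n) (hnN : n ≤ N) : (n : ℝ) ^ (1 - s.re) ≤ E := by
    have hn1 : (1 : ℝ) ≤ n := by exact_mod_cast hn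
    rcases le_total s.re 1 with h | h
    · exact (Real.rpow_le_rpow (by linarith) (by exact_mod_cast hnN) (by linarith)).trans hNE
    · exact (Real.rpow_le_one_of_one_le_of_nonpos hn1 (by linarith)).trans hE
  have hsum : ‖∑ k ∈ Finset.range N, ((k + 1 : ℕ) : ℂ) ^ (-s)‖ ≤ E * (1 + Real.log N) := by
    calc _ ≤ ∑ k ∈ Finset.range N, E * ((k + 1 : ℕ) : ℝ)⁻¹ := by
          refine norm_sum_le_of_le _ fun k hk ↦ ?_
          rw [hnorm _ k.succ_pos, neg_re, hsplit _ k.succ_pos]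
          gcongr
          exact hpow _ k.succ_pos (Finset.mem_range.mp hk)
      _ = E * (harmonic N : ℝ) := by
          rw [← Finset.mul_sum]
          simp [harmonic]
      _ ≤ _ := by
          gcongr
          exact harmonic_le_one_add_log N
  have hpole : ‖(N : ℂ) ^ (1 - s) / (s - 1)‖ ≤ E := by
    have h1 : 1 ≤ ‖s - 1‖ := by
      have := abs_im_le_norm (s - 1)
      simp only [sub_im, one_im, sub_zero] at this
      linarith [le_abs_self s.im]
    rw [norm_div, hnorm N hN]
    refine div_le_of_le_mul₀ (by positivity) (by positivity) ?_
    simp only [sub_re, one_re]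
    nlinarith
  have herr : ‖riemannZeta s - zetaApprox N s‖ ≤ E * 13 := by
    refine (norm_riemannZeta_sub_zetaApprox_le hN (by linarith) (by linarith)).trans ?_
    have h1 : ‖s‖ ≤ s.re + s.im := by
      have := norm_le_abs_re_add_abs_im s
      rwa [abs_of_nonneg (by linarith), abs_of_nonneg (by linarith)] at this
    have h2 : ‖s‖ / s.re ≤ 13 * N := by
      rw [div_le_iff₀ (by linarith)]
      nlinarith
    rw [hsplit N hN]
    calc _ ≤ 13 * N * (E * (N : ℝ)⁻¹) := by gcongr
      _ = _ := by field_simp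
  have h := norm_add_le (riemannZeta s - zetaApprox N s) (zetaApprox N s)
  rw [sub_add_cancel] at h
  have h' : ‖zetaApprox N s‖ ≤ _ := norm_add_le _ _
  linarith

/-- For every `A > 0` there is a constant `M > 0` (depending on `A`) such that
`|ζ(s)| ≤ M·log t` and `|ζ′(s)| ≤ M·(log t)²` for every `s = σ + it` with
`σ ≥ 1/2`, `σ > 1 − A/log t` and `t ≥ e`. -/
theorem zeta_and_deriv_bounds_near_one_line (A : ℝ) (hA : 0 < A) :
    ∃ M : ℝ, 0 < M ∧ ∀ σ t : ℝ, 1 / 2 ≤ σ → 1 - A / Real.log t < σ →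
      Real.exp 1 ≤ t →
        ‖riemannZeta ((σ : ℂ) + t * I)‖ ≤ M * Real.log t ∧
        ‖deriv riemannZeta ((σ : ℂ) + t * I)‖ ≤ M * (Real.log t) ^ 2 := by
  refine ⟨64 * Real.exp (A + 1), by positivity, fun σ t hσ hσA ht ↦ ?_⟩
  have ht2 : 2.7 < t := by linarith [Real.exp_one_gt_d9]
  have hL : 1 ≤ Real.log t := (Real.le_log_iff_exp_le (by linarith)).mpr ht
  set L := Real.log t
  set s : ℂ := (σ : ℂ) + t * I with hs
  have hre : s.re = σ := by simp [hs]
  have him : s.im = t := by simp [hs]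
  set r : ℝ := 1 / (4 * L) with hr
  have hr0 : 0 < r := by positivity
  have hr4 : r ≤ 1 / 4 := by
    rw [hr]
    gcongr
    linarith
  have key : ∀ z ∈ Metric.closedBall s r, ‖riemannZeta z‖ ≤ 16 * Real.exp (A + 1) * L := by
    intro z hz
    rw [Metric.mem_closedBall, dist_eq] at hz
    have h1 := abs_le.mp ((abs_re_le_norm (z - s)).trans hz)
    have h2 := abs_le.mp ((abs_im_le_norm (z - s)).trans hz)
    simp only [sub_re, sub_im, hre, him] at h1 h2
    have hN2 : 2 ≤ ⌊t⌋₊ := Nat.le_floor (by norm_num; linarith)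
    have hNt : (⌊t⌋₊ : ℝ) ≤ t := Nat.floor_le (by linarith)
    have hN2' : (2 : ℝ) ≤ ⌊t⌋₊ := by exact_mod_cast hN2
    have hNl : Real.log ⌊t⌋₊ ≤ L := Real.log_le_log (by linarith) hNt
    have hNl0 : 0 ≤ Real.log ⌊t⌋₊ := Real.log_nonneg (by linarith)
    have hlt := Nat.lt_floor_add_one t
    have hexp : (⌊t⌋₊ : ℝ) ^ (1 - z.re) ≤ Real.exp (A + 1) := by
      rw [Real.rpow_def_of_pos (by linarith)]
      refine Real.exp_le_exp.mpr ?_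
      have h3 : 1 - z.re ≤ A / L + r := by linarith
      calc _ ≤ Real.log ⌊t⌋₊ * (A / L + r) := by gcongr
        _ ≤ L * (A / L + r) := by gcongr
        _ = A + 1 / 4 := by
          rw [hr]
          field_simp
        _ ≤ _ := by linarith
    have h := norm_riemannZeta_le_of_rpow_le (s := z) (by lia : 1 ≤ ⌊t⌋₊) (by linarith)
      (by linarith) (by linarith) (Real.one_le_exp (by linarith)) hexp
    refine h.trans ?_
    rw [mul_comm 16, mul_assoc]
    gcongr
    linarith
  constructor
  · refine (key s (Metric.mem_closedBall_self hr0.le)).trans ?_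
    gcongr
    norm_num
  · have hd : DiffContOnCl ℂ riemannZeta (Metric.ball s r) := by
      refine DifferentiableOn.diffContOnCl fun z hz ↦
        (differentiableAt_riemannZeta ?_).differentiableWithinAt
      rintro rfl
      have h := Metric.mem_closedBall.mp (Metric.closure_ball_subset_closedBall hz)
      rw [dist_eq] at h
      have h2 := abs_le.mp ((abs_im_le_norm (1 - s)).trans h)
      simp only [sub_im, one_im, him] at h2
      linarith
    refine (norm_deriv_le_of_forall_mem_sphere_norm_le hr0 hd
      fun z hz ↦ key z (Metric.sphere_subset_closedBall hz)).trans (le_of_eq ?_)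
    rw [hr]
    field_simp
    ring
end

section
/- There exists a constant M > 0 such that for every s = σ + it with σ ≥ 1 and t ≥ e, one has |1/ζ(s)| < M·(log t)⁷ and |ζ′(s)/ζ(s)| < M·(log t)⁹. -/
open Complex

/-- Mean value inequality with a primitive `H` of a bound for the derivative. -/
lemma norm_sub_le_sub_of_norm_deriv_le {f f' : ℝ → ℂ} {H h : ℝ → ℝ} {a b : ℝ} (hab : a ≤ b)
    (hf : ∀ x, a ≤ x → HasDerivAt f (f' x) x) (hH : ∀ x, a ≤ x → HasDerivAt H (h x) x)
    (hb : ∀ x, a ≤ x → ‖f' x‖ ≤ h x) : ‖f b - f a‖ ≤ H b - H a := by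
  refine image_norm_le_of_norm_deriv_right_le_deriv_boundary' (f := fun x ↦ f x - f a)
    (f' := f') (B := fun x ↦ H x - H a) (B' := h) (a := a) (b := b) ?_ ?_ ?_ ?_ ?_ ?_
    (Set.right_mem_Icc.2 hab)
  · exact fun x hx ↦ ((hf x hx.1).sub_const _).continuousAt.continuousWithinAt
  · exact fun x hx ↦ ((hf x hx.1).sub_const _).hasDerivWithinAt
  · simp
  · exact fun x hx ↦ ((hH x hx.1).sub_const _).continuousAt.continuousWithinAt
  · exact fun x hx ↦ ((hH x hx.1).sub_const _).hasDerivWithinAt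
  · exact fun x hx ↦ hb x hx.1

/-- Comparison of the value at the right endpoint of a unit interval with the increment of a
primitive. -/
lemma norm_sub_primitive_le {F f f' : ℝ → ℂ} {H h : ℝ → ℝ} {a : ℝ}
    (hF : ∀ x, a ≤ x → HasDerivAt F (f x) x)
    (hf : ∀ x, a ≤ x → HasDerivAt f (f' x) x) (hH : ∀ x, a ≤ x → HasDerivAt H (h x) x)
    (hb : ∀ x, a ≤ x → ‖f' x‖ ≤ h x) :
    ‖f (a + 1) - (F (a + 1) - F a)‖ ≤ H (a + 1) - H a := by
  have key : ∀ x ∈ Set.Icc a (a + 1), ‖f (a + 1) - f x‖ ≤ H (a + 1) - H a := by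
    intro x hx
    have h1 : ‖f (a + 1) - f x‖ ≤ H (a + 1) - H x :=
      norm_sub_le_sub_of_norm_deriv_le hx.2 (fun y hy ↦ hf y (hx.1.trans hy))
        (fun y hy ↦ hH y (hx.1.trans hy)) (fun y hy ↦ hb y (hx.1.trans hy))
    have h2 : ‖f x - f a‖ ≤ H x - H a := norm_sub_le_sub_of_norm_deriv_le hx.1 hf hH hb
    linarith [norm_nonneg (f x - f a)]
  have hG : ∀ x, a ≤ x → HasDerivAt (fun x : ℝ ↦ (x : ℂ) * f (a + 1) - F x)
      (f (a + 1) - f x) x := by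
    intro x hx
    refine HasDerivAt.congr_deriv
      (((HasDerivAt.ofReal_comp (hasDerivAt_id x)).mul_const (f (a + 1))).sub (hF x hx)) ?_
    simp
  have := norm_image_sub_le_of_norm_deriv_le_segment' (f := fun x : ℝ ↦ (x : ℂ) * f (a + 1) - F x)
    (fun x hx ↦ (hG x hx.1).hasDerivWithinAt)
    (fun x hx ↦ key x (Set.Ico_subset_Icc_self hx)) (a + 1) (Set.right_mem_Icc.2 (by linarith))
  simp only [add_sub_cancel_left, mul_one] at this
  refine le_of_eq_of_le (congrArg norm ?_) this
  push_cast
  ring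

open Filter Topology Finset in
/-- A form of the Euler–Maclaurin estimate for the tail of an infinite sum. -/
lemma HasSum.norm_sub_sum_add_primitive_le {g : ℕ → ℂ} {S : ℂ} (hg : HasSum g S)
    {F f f' : ℝ → ℂ} {H h : ℝ → ℝ} {N : ℕ}
    (hgf : ∀ n, N ≤ n → g (n + 1) = f (n + 1))
    (hF : ∀ x, (N : ℝ) ≤ x → HasDerivAt F (f x) x)
    (hf : ∀ x, (N : ℝ) ≤ x → HasDerivAt f (f' x) x)
    (hH : ∀ x, (N : ℝ) ≤ x → HasDerivAt H (h x) x)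
    (hb : ∀ x, (N : ℝ) ≤ x → ‖f' x‖ ≤ h x)
    (hF0 : Tendsto F atTop (𝓝 0)) (hH0 : ∀ x, (N : ℝ) ≤ x → H x ≤ 0) :
    ‖S - ∑ n ∈ range (N + 1), g n + F N‖ ≤ -H N := by
  have fin : ∀ k : ℕ, ‖∑ n ∈ range (N + k + 1), g n - ∑ n ∈ range (N + 1), g n
      - (F ((N + k : ℕ) : ℝ) - F N)‖ ≤ H ((N + k : ℕ) : ℝ) - H N := by
    intro k
    induction k with
    | zero => simp
    | succ k ih =>
      have hle : (N : ℝ) ≤ ((N + k : ℕ) : ℝ) := by exact_mod_cast Nat.le_add_right N k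
      have step := norm_sub_primitive_le (fun y hy ↦ hF y (hle.trans hy))
        (fun y hy ↦ hf y (hle.trans hy)) (fun y hy ↦ hH y (hle.trans hy))
        (fun y hy ↦ hb y (hle.trans hy))
      rw [← hgf (N + k) (Nat.le_add_right N k)] at step
      have hc : ((N + (k + 1) : ℕ) : ℝ) = ((N + k : ℕ) : ℝ) + 1 := by push_cast; ring
      rw [hc, ← add_assoc N k 1, sum_range_succ _ (N + k + 1)]
      refine le_trans (le_of_eq ?_) ((norm_add_le_of_le ih step).trans (le_of_eq ?_))
      · congr 1; ring
      · ring
  have ht : Tendsto (fun k : ℕ ↦ ‖∑ n ∈ range (N + k + 1), g n - ∑ n ∈ range (N + 1), g n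
      - (F ((N + k : ℕ) : ℝ) - F N)‖) atTop
      (𝓝 ‖S - ∑ n ∈ range (N + 1), g n - (0 - F N)‖) := by
    have e : Tendsto (fun k : ℕ ↦ N + k) atTop atTop :=
      tendsto_atTop_mono (fun k ↦ Nat.le_add_left k N) tendsto_id
    have e1 : Tendsto (fun k : ℕ ↦ N + k + 1) atTop atTop := (tendsto_add_atTop_nat 1).comp e
    exact (((hg.tendsto_sum_nat.comp e1).sub_const _).sub
      (((hF0.comp tendsto_natCast_atTop_atTop).comp e).sub_const _)).norm
  rw [zero_sub, sub_neg_eq_add] at ht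
  refine le_of_tendsto ht (Eventually.of_forall fun k ↦ (fin k).trans ?_)
  have := hH0 ((N + k : ℕ) : ℝ) (by exact_mod_cast Nat.le_add_right N k)
  linarith

lemma norm_ofReal_cpow_neg_sub_one_le {s : ℂ} (hs : 1 ≤ s.re) {x : ℝ} (hx : 1 ≤ x) :
    ‖(x : ℂ) ^ (-s - 1)‖ ≤ 1 / x ^ 2 := by
  have h0 : 0 < x := by linarith
  rw [norm_cpow_eq_rpow_re_of_pos h0, one_div, ← Real.rpow_natCast, ← Real.rpow_neg h0.le]
  apply Real.rpow_le_rpow_of_exponent_le hx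
  simp
  linarith

lemma norm_ofReal_cpow_one_sub_le_one {s : ℂ} (hs : 1 ≤ s.re) {x : ℝ} (hx : 1 ≤ x) :
    ‖(x : ℂ) ^ (1 - s)‖ ≤ 1 := by
  have h0 : 0 < x := by linarith
  rw [norm_cpow_eq_rpow_re_of_pos h0]
  apply Real.rpow_le_one_of_one_le_of_nonpos hx
  simpa using hs

lemma hasDerivAt_primitive_cpow {s : ℂ} (hs : 1 < s.re) {x : ℝ} (hx : x ≠ 0) :
    HasDerivAt (fun y : ℝ ↦ (y : ℂ) ^ (1 - s) / (1 - s)) ((x : ℂ) ^ (-s)) x := by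
  have h1 : 1 - s ≠ 0 := by
    intro h
    have := congrArg re h
    simp at this
    linarith
  refine HasDerivAt.congr_deriv ((hasDerivAt_ofReal_cpow_const hx h1).div_const (1 - s)) ?_
  rw [mul_div_cancel_left₀ _ h1]
  congr 1
  ring

lemma hasDerivAt_cpow_neg {s : ℂ} (hs : 1 < s.re) {x : ℝ} (hx : x ≠ 0) :
    HasDerivAt (fun y : ℝ ↦ (y : ℂ) ^ (-s)) (-s * (x : ℂ) ^ (-s - 1)) x := by
  have h1 : -s ≠ 0 := by
    intro h
    have := congrArg re h
    simp at this
    linarith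
  exact hasDerivAt_ofReal_cpow_const hx h1

open Filter Topology Finset in
/-- Truncation of the Dirichlet series of `ζ`. -/
lemma norm_riemannZeta_sub_sum_le {s : ℂ} (hs : 1 < s.re) {N : ℕ} (hN : 1 ≤ N) :
    ‖riemannZeta s - ∑ n ∈ range (N + 1), LSeries.term 1 s n + (N : ℂ) ^ (1 - s) / (1 - s)‖
      ≤ ‖s‖ / N := by
  have hN' : (1 : ℝ) ≤ N := by exact_mod_cast hN
  have := HasSum.norm_sub_sum_add_primitive_le (LSeriesHasSum_one hs) (N := N)
    (F := fun y : ℝ ↦ (y : ℂ) ^ (1 - s) / (1 - s)) (f := fun y : ℝ ↦ (y : ℂ) ^ (-s))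
    (f' := fun x ↦ -s * (x : ℂ) ^ (-s - 1)) (H := fun x ↦ -(‖s‖ / x)) (h := fun x ↦ ‖s‖ / x ^ 2)
    ?_ ?_ ?_ ?_ ?_ ?_ ?_
  · simpa using this
  · intro n _
    rw [LSeries.term_of_ne_zero (by omega), cpow_neg]
    simp
  · exact fun x hx ↦ hasDerivAt_primitive_cpow hs (by linarith)
  · exact fun x hx ↦ hasDerivAt_cpow_neg hs (by linarith)
  · intro x hx
    have hx0 : x ≠ 0 := by linarith
    refine HasDerivAt.congr_deriv ((hasDerivAt_inv hx0).const_mul ‖s‖).neg ?_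
    ring
  · intro x hx
    rw [norm_mul, norm_neg, div_eq_mul_one_div]
    gcongr
    exact norm_ofReal_cpow_neg_sub_one_le hs.le (hN'.trans hx)
  · have : Tendsto (fun x : ℝ ↦ x ^ (-(s.re - 1))) atTop (𝓝 0) :=
      tendsto_rpow_neg_atTop (by linarith)
    have h2 : Tendsto (fun x : ℝ ↦ (x : ℂ) ^ (1 - s)) atTop (𝓝 0) := by
      rw [tendsto_zero_iff_norm_tendsto_zero]
      refine this.congr' ?_
      filter_upwards [eventually_gt_atTop 0] with x hx
      rw [norm_cpow_eq_rpow_re_of_pos hx]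
      simp
    simpa using h2.div_const (1 - s)
  · intro x hx
    have : 0 ≤ x := by linarith
    simp only [Left.neg_nonpos_iff]
    positivity

lemma LSeriesHasSum_logMul_one {s : ℂ} (hs : 1 < s.re) :
    LSeriesHasSum (LSeries.logMul 1) s (-deriv riemannZeta s) := by
  have ha : LSeries.abscissaOfAbsConv 1 < s.re := by
    rw [LSeries.abscissaOfAbsConv_one]; exact_mod_cast hs
  have he : deriv riemannZeta s = deriv (LSeries 1) s := by
    apply Filter.EventuallyEq.deriv_eq
    filter_upwards [(isOpen_lt continuous_const continuous_re).mem_nhds hs] with z hz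
    exact (LSeries_one_eq_riemannZeta hz).symm
  rw [he, LSeries_deriv ha, neg_neg]
  exact (LSeriesSummable_logMul_of_lt_re ha).LSeriesHasSum

open Filter Topology Finset in
/-- Truncation of the Dirichlet series of `ζ'`. -/
lemma norm_neg_deriv_riemannZeta_sub_sum_le {s : ℂ} (hs : 1 < s.re) {N : ℕ} (hN : 1 ≤ N) :
    ‖-deriv riemannZeta s - ∑ n ∈ range (N + 1), LSeries.term (LSeries.logMul 1) s n
      + (N : ℂ) ^ (1 - s) / (1 - s) * (Real.log N - 1 / (1 - s))‖
      ≤ (‖s‖ * (Real.log N + 1) + 1) / N := by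
  have hN' : (1 : ℝ) ≤ N := by exact_mod_cast hN
  have h1 : 1 - s ≠ 0 := by
    intro h
    have := congrArg re h
    simp at this
    linarith
  have := HasSum.norm_sub_sum_add_primitive_le (LSeriesHasSum_logMul_one hs) (N := N)
    (F := fun y : ℝ ↦ (y : ℂ) ^ (1 - s) / (1 - s) * (Real.log y - 1 / (1 - s)))
    (f := fun y : ℝ ↦ Real.log y * (y : ℂ) ^ (-s))
    (f' := fun x ↦ (1 / x : ℝ) * (x : ℂ) ^ (-s) + Real.log x * (-s * (x : ℂ) ^ (-s - 1)))
    (H := fun x ↦ -((‖s‖ * (Real.log x + 1) + 1) / x))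
    (h := fun x ↦ (‖s‖ * Real.log x + 1) / x ^ 2)
    ?_ ?_ ?_ ?_ ?_ ?_ ?_
  · simpa using this
  · intro n _
    rw [LSeries.term_of_ne_zero (by omega), cpow_neg, LSeries.logMul]
    have h : Complex.log ((n : ℂ) + 1) = Real.log ((n : ℝ) + 1) := by
      exact_mod_cast (natCast_log (n := n + 1)).symm
    simp [h, div_eq_mul_inv]
  · intro x hx
    have hx0 : x ≠ 0 := by linarith
    have hxc : (x : ℂ) ≠ 0 := by exact_mod_cast hx0
    refine HasDerivAt.congr_deriv ((hasDerivAt_primitive_cpow hs hx0).mul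
      (((Real.hasDerivAt_log hx0).ofReal_comp).sub_const (1 / (1 - s)))) ?_
    rw [sub_eq_add_neg 1 s, cpow_add _ _ hxc, cpow_one, ← sub_eq_add_neg]
    push_cast
    field_simp
    ring
  · intro x hx
    have hx0 : x ≠ 0 := by linarith
    refine HasDerivAt.congr_deriv
      (((Real.hasDerivAt_log hx0).ofReal_comp).mul (hasDerivAt_cpow_neg hs hx0)) ?_
    simp
  · intro x hx
    have hx0 : x ≠ 0 := by linarith
    refine HasDerivAt.congr_deriv ((((((Real.hasDerivAt_log hx0).add_const 1).const_mul
      ‖s‖).add_const 1).div (hasDerivAt_id x) hx0).neg) ?_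
    simp only [id]
    field_simp
    ring
  · intro x hx
    have hx1 : 1 ≤ x := hN'.trans hx
    have hx0 : 0 < x := by linarith
    have hxc : (x : ℂ) ≠ 0 := by exact_mod_cast hx0.ne'
    have e : (1 / x : ℝ) * (x : ℂ) ^ (-s) + Real.log x * (-s * (x : ℂ) ^ (-s - 1))
        = (1 - s * Real.log x) * (x : ℂ) ^ (-s - 1) := by
      rw [cpow_sub _ _ hxc, cpow_one]
      push_cast
      field_simp
      ring
    rw [e, norm_mul, div_eq_mul_one_div]
    have hl := Real.log_nonneg hx1
    gcongr
    · refine (norm_sub_le _ _).trans ?_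
      rw [norm_mul, norm_real, Real.norm_of_nonneg hl, norm_one, add_comm]
    · exact norm_ofReal_cpow_neg_sub_one_le hs.le hx1
  · have t1 : Tendsto (fun x : ℝ ↦ x ^ (-(s.re - 1))) atTop (𝓝 0) :=
      tendsto_rpow_neg_atTop (by linarith)
    have t2 : Tendsto (fun x : ℝ ↦ Real.log x / x ^ (s.re - 1)) atTop (𝓝 0) :=
      (isLittleO_log_rpow_atTop (by linarith)).tendsto_div_nhds_zero
    have h2 : Tendsto (fun x : ℝ ↦ (x : ℂ) ^ (1 - s)) atTop (𝓝 0) := by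
      rw [tendsto_zero_iff_norm_tendsto_zero]
      refine t1.congr' ?_
      filter_upwards [eventually_gt_atTop 0] with x hx
      rw [norm_cpow_eq_rpow_re_of_pos hx]
      simp
    have h3 : Tendsto (fun x : ℝ ↦ (x : ℂ) ^ (1 - s) * Real.log x) atTop (𝓝 0) := by
      rw [tendsto_zero_iff_norm_tendsto_zero]
      refine t2.congr' ?_
      filter_upwards [eventually_gt_atTop 1] with x hx
      have hx0 : 0 < x := by linarith
      rw [norm_mul, norm_cpow_eq_rpow_re_of_pos hx0, norm_real,
        Real.norm_of_nonneg (Real.log_nonneg hx.le), div_eq_mul_inv, ← Real.rpow_neg hx0.le,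
        mul_comm]
      simp
    have := (h3.div_const (1 - s)).sub (h2.mul_const (1 / (1 - s) ^ 2))
    simp only [zero_div, zero_mul, sub_zero] at this
    refine this.congr fun x ↦ ?_
    field_simp
  · intro x hx
    have : 0 ≤ x := by linarith
    have := Real.log_nonneg (hN'.trans hx)
    simp only [Left.neg_nonpos_iff]
    positivity

lemma norm_term_one_le {s : ℂ} (hs : 1 ≤ s.re) (n : ℕ) : ‖LSeries.term 1 s n‖ ≤ (n : ℝ)⁻¹ := by
  refine (LSeries.norm_term_le_of_re_le_re 1 (s := 1) (by simpa using hs) n).trans ?_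
  rcases eq_or_ne n 0 with rfl | hn
  · simp
  · simp [LSeries.term_of_ne_zero hn]

open Finset in
lemma sum_range_succ_inv_le (N : ℕ) :
    ∑ n ∈ range (N + 1), (n : ℝ)⁻¹ ≤ 1 + Real.log N := by
  have := harmonic_le_one_add_log N
  rw [sum_range_succ']
  simpa [harmonic] using this

open Finset in
lemma norm_sum_term_one_le {s : ℂ} (hs : 1 ≤ s.re) (N : ℕ) :
    ‖∑ n ∈ range (N + 1), LSeries.term 1 s n‖ ≤ 1 + Real.log N :=
  (norm_sum_le_of_le _ fun n _ ↦ norm_term_one_le hs n).trans (sum_range_succ_inv_le N)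

open Finset in
lemma norm_sum_term_logMul_one_le {s : ℂ} (hs : 1 ≤ s.re) (N : ℕ) :
    ‖∑ n ∈ range (N + 1), LSeries.term (LSeries.logMul 1) s n‖
      ≤ Real.log N * (1 + Real.log N) := by
  have hN : 0 ≤ Real.log N := Real.log_natCast_nonneg N
  have h : ∀ n ∈ range (N + 1), ‖LSeries.term (LSeries.logMul 1) s n‖
      ≤ Real.log N * (n : ℝ)⁻¹ := by
    intro n hn
    rcases eq_or_ne n 0 with rfl | hn0
    · simp
    have e : LSeries.term (LSeries.logMul 1) s n = Real.log n * LSeries.term 1 s n := by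
      rw [LSeries.term_of_ne_zero hn0, LSeries.term_of_ne_zero hn0, LSeries.logMul, natCast_log,
        mul_div_assoc]
    rw [e, norm_mul, norm_real, Real.norm_of_nonneg (Real.log_natCast_nonneg n)]
    have h1 : (0 : ℝ) < n := by exact_mod_cast Nat.pos_of_ne_zero hn0
    have h2 : (n : ℝ) ≤ N := by exact_mod_cast Nat.lt_succ_iff.1 (mem_range.1 hn)
    gcongr
    exact norm_term_one_le hs n
  refine (norm_sum_le_of_le _ h).trans ?_
  rw [← mul_sum]
  gcongr
  exact sum_range_succ_inv_le N

lemma exists_nat_cutoff {s : ℂ} (h1 : 1 < s.re) (h2 : s.re ≤ 2) (ht : Real.exp 1 ≤ s.im) :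
    ∃ N : ℕ, 1 ≤ N ∧ Real.log N ≤ 2 * Real.log s.im ∧ ‖s‖ ≤ 2 * N ∧ 1 ≤ ‖1 - s‖ := by
  have he : 2 ≤ s.im := by linarith [Real.add_one_le_exp 1]
  have hle := Nat.le_ceil s.im
  refine ⟨⌈s.im⌉₊, Nat.one_le_ceil_iff.2 (by linarith), ?_, ?_, ?_⟩
  · rw [← Nat.cast_two, ← Real.log_pow]
    apply Real.log_le_log (by linarith)
    have := Nat.ceil_lt_add_one (a := s.im) (by linarith)
    nlinarith
  · have := norm_le_abs_re_add_abs_im s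
    rw [abs_of_nonneg (by linarith : 0 ≤ s.re), abs_of_nonneg (by linarith : 0 ≤ s.im)] at this
    linarith
  · have := abs_im_le_norm (1 - s)
    simp only [sub_im, one_im, zero_sub, abs_neg] at this
    linarith [le_abs_self s.im]

lemma norm_riemannZeta_le_log {s : ℂ} (h1 : 1 < s.re) (h2 : s.re ≤ 2)
    (ht : Real.exp 1 ≤ s.im) : ‖riemannZeta s‖ ≤ 6 * Real.log s.im := by
  obtain ⟨N, hN, hlog, hs, h1s⟩ := exists_nat_cutoff h1 h2 ht
  have hL : 1 ≤ Real.log s.im := (Real.le_log_iff_exp_le ((Real.exp_pos 1).trans_le ht)).2 ht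
  have hN' : (1 : ℝ) ≤ N := by exact_mod_cast hN
  have m := norm_riemannZeta_sub_sum_le h1 hN
  have m1 := norm_sum_term_one_le h1.le N
  have m2 : ‖(N : ℂ) ^ (1 - s) / (1 - s)‖ ≤ 1 := by
    rw [norm_div]
    exact div_le_one_of_le₀ (((norm_ofReal_cpow_one_sub_le_one h1.le hN')).trans h1s)
      (norm_nonneg _)
  have m3 : ‖s‖ / N ≤ 2 := (div_le_iff₀ (by linarith)).2 hs
  set S := ∑ n ∈ Finset.range (N + 1), LSeries.term 1 s n
  set F := (N : ℂ) ^ (1 - s) / (1 - s)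
  have e : riemannZeta s = (riemannZeta s - S + F) + S - F := by ring
  rw [e]
  have := norm_sub_le ((riemannZeta s - S + F) + S) F
  have := norm_add_le (riemannZeta s - S + F) S
  linarith

lemma norm_deriv_riemannZeta_le_log_sq {s : ℂ} (h1 : 1 < s.re) (h2 : s.re ≤ 2)
    (ht : Real.exp 1 ≤ s.im) : ‖deriv riemannZeta s‖ ≤ 16 * Real.log s.im ^ 2 := by
  obtain ⟨N, hN, hlog, hs, h1s⟩ := exists_nat_cutoff h1 h2 ht
  have hL : 1 ≤ Real.log s.im := (Real.le_log_iff_exp_le ((Real.exp_pos 1).trans_le ht)).2 ht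
  have hN' : (1 : ℝ) ≤ N := by exact_mod_cast hN
  have hN0 : 0 ≤ Real.log N := Real.log_natCast_nonneg N
  have m := norm_neg_deriv_riemannZeta_sub_sum_le h1 hN
  have m1 := norm_sum_term_logMul_one_le h1.le N
  have m2 : ‖(N : ℂ) ^ (1 - s) / (1 - s) * (Real.log N - 1 / (1 - s))‖ ≤ Real.log N + 1 := by
    have a1 : ‖(N : ℂ) ^ (1 - s) / (1 - s)‖ ≤ 1 := by
      rw [norm_div]
      exact div_le_one_of_le₀ (((norm_ofReal_cpow_one_sub_le_one h1.le hN')).trans h1s)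
        (norm_nonneg _)
    have a2 : ‖(Real.log N - 1 / (1 - s) : ℂ)‖ ≤ Real.log N + 1 := by
      refine (norm_sub_le _ _).trans ?_
      rw [norm_real, Real.norm_of_nonneg hN0, norm_div, norm_one]
      gcongr
      exact div_le_one_of_le₀ h1s (norm_nonneg _)
    rw [norm_mul]
    exact (mul_le_of_le_one_left (norm_nonneg _) a1).trans a2
  have m3 : (‖s‖ * (Real.log N + 1) + 1) / N ≤ 2 * (Real.log N + 1) + 1 := by
    rw [div_le_iff₀ (by linarith)]
    nlinarith
  set S := ∑ n ∈ Finset.range (N + 1), LSeries.term (LSeries.logMul 1) s n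
  set F := (N : ℂ) ^ (1 - s) / (1 - s) * (Real.log N - 1 / (1 - s))
  rw [← norm_neg]
  have e : -deriv riemannZeta s = (-deriv riemannZeta s - S + F) + S - F := by ring
  rw [e]
  have := norm_sub_le ((-deriv riemannZeta s - S + F) + S) F
  have := norm_add_le (-deriv riemannZeta s - S + F) S
  nlinarith

lemma norm_riemannZeta_ofReal_le {σ : ℝ} (h1 : 1 < σ) (h2 : σ ≤ 2) :
    ‖riemannZeta σ‖ ≤ 4 / (σ - 1) := by
  have m := norm_riemannZeta_sub_sum_le (s := σ) (by simpa using h1) le_rfl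
  have hs : (∑ n ∈ Finset.range (1 + 1), LSeries.term 1 (σ : ℂ) n) = 1 := by
    simp [Finset.sum_range_succ]
  have hF : ‖1 / (1 - (σ : ℂ))‖ = 1 / (σ - 1) := by
    rw [norm_div, norm_one, norm_sub_rev, ← ofReal_one, ← ofReal_sub, norm_real,
      Real.norm_of_nonneg (by linarith)]
  rw [hs, Nat.cast_one, one_cpow, norm_real, Real.norm_of_nonneg (by linarith), Nat.cast_one,
    div_one] at m
  have e : riemannZeta σ = (riemannZeta σ - 1 + 1 / (1 - (σ : ℂ))) + 1 - 1 / (1 - (σ : ℂ)) := by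
    ring
  have i1 := norm_sub_le ((riemannZeta σ - 1 + 1 / (1 - (σ : ℂ))) + 1) (1 / (1 - (σ : ℂ)))
  have i2 := norm_add_le (riemannZeta σ - 1 + 1 / (1 - (σ : ℂ))) 1
  rw [← e] at i1
  rw [norm_one] at i2
  have h3 : 1 ≤ 1 / (σ - 1) := by rw [le_div_iff₀] <;> linarith
  have h4 : 4 / (σ - 1) = 4 * (1 / (σ - 1)) := by ring
  linarith

/-- The lower bound for `ζ` coming from the `3-4-1` inequality. -/
lemma sub_one_pow_three_le_norm_riemannZeta {σ t : ℝ} (h1 : 1 < σ) (h2 : σ ≤ 2)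
    (ht : Real.exp 1 ≤ t) :
    (σ - 1) ^ 3 ≤ 768 * Real.log t * ‖riemannZeta (σ + t * I)‖ ^ 4 := by
  have ht0 : 2 ≤ t := by linarith [Real.add_one_le_exp 1]
  have hp := DirichletCharacter.norm_LFunction_product_ge_one (1 : DirichletCharacter ℂ 1)
    (sub_pos.2 h1) t
  simp only [DirichletCharacter.LFunctionTrivChar, DirichletCharacter.LFunction_modOne_eq] at hp
  have e0 : (1 + (σ - 1 : ℝ) : ℂ) = σ := by push_cast; ring
  have e1 : (σ : ℂ) + I * t = σ + t * I := by ring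
  have e2 : (σ : ℂ) + 2 * I * t = σ + (2 * t : ℝ) * I := by push_cast; ring
  rw [e0, e1, e2, norm_mul, norm_mul, norm_pow, norm_pow] at hp
  have b0 := norm_riemannZeta_ofReal_le h1 h2
  have b2 : ‖riemannZeta (σ + (2 * t : ℝ) * I)‖ ≤ 12 * Real.log t := by
    have := norm_riemannZeta_le_log (s := σ + (2 * t : ℝ) * I) (by simpa using h1)
      (by simpa using h2) (by simp; linarith)
    refine this.trans ?_
    simp only [add_im, ofReal_im, mul_im, ofReal_re, I_im, mul_one, I_re, mul_zero, add_zero,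
      zero_add]
    rw [Real.log_mul (by norm_num) (by linarith)]
    linarith [Real.log_le_log (by norm_num) ht0]
  have hσ : 0 < σ - 1 := by linarith
  have : 1 ≤ (4 / (σ - 1)) ^ 3 * ‖riemannZeta (σ + t * I)‖ ^ 4 * (12 * Real.log t) :=
    hp.le.trans (by gcongr)
  calc (σ - 1) ^ 3 = (σ - 1) ^ 3 * 1 := (mul_one _).symm
    _ ≤ (σ - 1) ^ 3 * ((4 / (σ - 1)) ^ 3 * ‖riemannZeta (σ + t * I)‖ ^ 4 * (12 * Real.log t)) := by
      gcongr
    _ = _ := by field_simp; ring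

lemma norm_riemannZeta_ge_of_far {σ t c : ℝ} (hc : 0 < c) (hc' : c * (768 * 32 ^ 4) = 1)
    (h1 : 1 + c / Real.log t ^ 9 ≤ σ) (h2 : σ ≤ 2) (ht : Real.exp 1 ≤ t) :
    32 * c / Real.log t ^ 7 ≤ ‖riemannZeta (σ + t * I)‖ := by
  have hL : 1 ≤ Real.log t := (Real.le_log_iff_exp_le ((Real.exp_pos 1).trans_le ht)).2 ht
  have hpos : 0 < c / Real.log t ^ 9 := by positivity
  have h := sub_one_pow_three_le_norm_riemannZeta (by linarith) h2 ht
  have h3 : (c / Real.log t ^ 9) ^ 3 ≤ (σ - 1) ^ 3 := by gcongr; linarith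
  refine le_of_pow_le_pow_left₀ four_ne_zero (norm_nonneg _) ?_
  have h4 := h3.trans h
  have e : 768 * Real.log t * (32 * c / Real.log t ^ 7) ^ 4 = (c / Real.log t ^ 9) ^ 3 := by
    field_simp
    linear_combination hc'
  rw [← e] at h4
  exact le_of_mul_le_mul_left h4 (by positivity)

lemma norm_riemannZeta_ge {σ t c : ℝ} (hc : 0 < c) (hc' : c * (768 * 32 ^ 4) = 1)
    (h1 : 1 < σ) (h2 : σ ≤ 2) (ht : Real.exp 1 ≤ t) :
    16 * c / Real.log t ^ 7 ≤ ‖riemannZeta (σ + t * I)‖ := by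
  have hL : 1 ≤ Real.log t := (Real.le_log_iff_exp_le ((Real.exp_pos 1).trans_le ht)).2 ht
  have hpos : 0 < c / Real.log t ^ 9 := by positivity
  have e32 : 32 * c / Real.log t ^ 7 = 2 * (16 * c / Real.log t ^ 7) := by ring
  have p16 : 0 < 16 * c / Real.log t ^ 7 := by positivity
  rcases le_or_gt (1 + c / Real.log t ^ 9) σ with h | h
  · linarith [norm_riemannZeta_ge_of_far hc hc' h h2 ht]
  set η := 1 + c / Real.log t ^ 9 with hη
  have hη2 : η ≤ 2 := by
    have : c / Real.log t ^ 9 ≤ 1 :=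
      div_le_one_of_le₀ (by linarith [one_le_pow₀ hL (n := 9)]) (by positivity)
    linarith
  have hfar := norm_riemannZeta_ge_of_far hc hc' hη.ge hη2 ht
  have hd : ∀ x ∈ Set.Icc σ η, HasDerivWithinAt (fun x : ℝ ↦ riemannZeta (x + t * I))
      (deriv riemannZeta (x + t * I)) (Set.Icc σ η) x := by
    intro x hx
    have hne : (x + t * I : ℂ) ≠ 1 := by
      intro hx1
      have := congrArg re hx1
      simp at this
      linarith [hx.1]
    exact ((differentiableAt_riemannZeta hne).hasDerivAt.comp_add_const
      (x : ℂ) (t * I)).comp_ofReal.hasDerivWithinAt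
  have hm := norm_image_sub_le_of_norm_deriv_le_segment' hd (C := 16 * Real.log t ^ 2)
    (fun x hx ↦ by
      simpa using norm_deriv_riemannZeta_le_log_sq (s := x + t * I) (by simp; linarith [hx.1])
        (by simp; linarith [hx.2]) (by simpa using ht)) η (Set.right_mem_Icc.2 h.le)
  have hm2 : 16 * Real.log t ^ 2 * (η - σ) ≤ 16 * c / Real.log t ^ 7 := by
    calc 16 * Real.log t ^ 2 * (η - σ) ≤ 16 * Real.log t ^ 2 * (c / Real.log t ^ 9) := by
          gcongr; linarith
      _ = _ := by field_simp
  have := norm_sub_norm_le (riemannZeta (η + t * I)) (riemannZeta (σ + t * I))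
  linarith

lemma exists_norm_LSeries_le {f : ℕ → ℂ} (hf : LSeriesSummable f 2) :
    ∃ K : ℝ, 0 ≤ K ∧ ∀ s : ℂ, 2 ≤ s.re → ‖LSeries f s‖ ≤ K := by
  refine ⟨∑' n, ‖LSeries.term f 2 n‖, tsum_nonneg fun _ ↦ norm_nonneg _, fun s hs ↦ ?_⟩
  exact tsum_of_norm_bounded hf.norm.hasSum
    fun n ↦ LSeries.norm_term_le_of_re_le_re f (by simpa using hs) n

lemma exists_bounds_of_one_lt :
    ∃ M : ℝ, 0 < M ∧ ∀ σ t : ℝ, 1 < σ → Real.exp 1 ≤ t →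
      ‖1 / riemannZeta ((σ : ℂ) + t * I)‖ ≤ M * (Real.log t) ^ 7 ∧
      ‖deriv riemannZeta ((σ : ℂ) + t * I) / riemannZeta ((σ : ℂ) + t * I)‖ ≤
        M * (Real.log t) ^ 9 := by
  obtain ⟨K₁, hK₁, hm⟩ := exists_norm_LSeries_le
    (ArithmeticFunction.LSeriesSummable_moebius_iff (s := 2).2 (by norm_num))
  obtain ⟨K₂, hK₂, hv⟩ := exists_norm_LSeries_le
    (ArithmeticFunction.LSeriesSummable_vonMangoldt (s := 2) (by norm_num))
  obtain ⟨c, hc, hc'⟩ : ∃ c : ℝ, 0 < c ∧ c * (768 * 32 ^ 4) = 1 :=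
    ⟨1 / (768 * 32 ^ 4), by norm_num, by norm_num⟩
  refine ⟨K₁ + K₂ + 1 / c, by positivity, fun σ t hσ ht ↦ ?_⟩
  have hL : 1 ≤ Real.log t := (Real.le_log_iff_exp_le ((Real.exp_pos 1).trans_le ht)).2 ht
  have hre : ((σ : ℂ) + t * I).re = σ := by simp
  have him : ((σ : ℂ) + t * I).im = t := by simp
  set s : ℂ := (σ : ℂ) + t * I with hs
  have hσ' : 1 < s.re := by rwa [hre]
  have hz := riemannZeta_ne_zero_of_one_lt_re hσ'
  have hic : 0 < 1 / c := by positivity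
  rcases le_or_gt 2 σ with h2 | h2
  · have h7 := one_le_pow₀ hL (n := 7)
    have h9 := one_le_pow₀ hL (n := 9)
    constructor
    · have e : 1 / riemannZeta s = LSeries (fun n ↦ (ArithmeticFunction.moebius n : ℂ)) s := by
        rw [div_eq_iff hz, mul_comm]
        rw [← ArithmeticFunction.LSeries_zeta_eq_riemannZeta hσ',
          ArithmeticFunction.LSeries_zeta_mul_Lseries_moebius hσ']
      rw [e]
      nlinarith [hm s (by rwa [hre])]
    · have := hv s (by rwa [hre])
      rw [ArithmeticFunction.LSeries_vonMangoldt_eq_deriv_riemannZeta_div hσ', neg_div,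
        norm_neg] at this
      nlinarith
  · have hge := norm_riemannZeta_ge hc hc' hσ h2.le ht
    have hd := norm_deriv_riemannZeta_le_log_sq hσ' (by linarith) (him ▸ ht)
    rw [← hs] at hge
    rw [him] at hd
    have hinv : ‖1 / riemannZeta s‖ ≤ Real.log t ^ 7 / (16 * c) := by
      rw [norm_div, norm_one]
      refine (one_div_le_one_div_of_le (by positivity) hge).trans_eq ?_
      field_simp
    constructor
    · refine hinv.trans ?_
      have : Real.log t ^ 7 / (16 * c) = 1 / 16 * (1 / c) * Real.log t ^ 7 := by field_simp
      rw [this]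
      gcongr
      linarith
    · rw [div_eq_mul_one_div, norm_mul]
      calc _ ≤ 16 * Real.log t ^ 2 * (Real.log t ^ 7 / (16 * c)) := by gcongr
        _ = 1 / c * Real.log t ^ 9 := by field_simp
        _ ≤ _ := by gcongr; linarith

/-- There is a constant `M > 0` such that for every `s = σ + it` with `σ ≥ 1`
and `t ≥ e`, `|1/ζ(s)| < M·(log t)⁷` and `|ζ′(s)/ζ(s)| < M·(log t)⁹`. -/
theorem inv_zeta_and_logDeriv_bounds :
    ∃ M : ℝ, 0 < M ∧ ∀ σ t : ℝ, 1 ≤ σ → Real.exp 1 ≤ t →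
      ‖1 / riemannZeta ((σ : ℂ) + t * I)‖ < M * (Real.log t) ^ 7 ∧
      ‖deriv riemannZeta ((σ : ℂ) + t * I) / riemannZeta ((σ : ℂ) + t * I)‖ <
        M * (Real.log t) ^ 9 := by
  obtain ⟨M, hM, h⟩ := exists_bounds_of_one_lt
  refine ⟨M + 1, by positivity, fun σ t hσ ht ↦ ?_⟩
  have hL : 1 ≤ Real.log t := (Real.le_log_iff_exp_le ((Real.exp_pos 1).trans_le ht)).2 ht
  have ht0 : t ≠ 0 := ((Real.exp_pos 1).trans_le ht).ne'
  have hne : (σ + t * I : ℂ) ≠ 1 := by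
    intro h1
    have := congrArg im h1
    simp at this
    exact ht0 this
  have hz : riemannZeta (σ + t * I) ≠ 0 := riemannZeta_ne_zero_of_one_le_re (by simpa using hσ)
  have hmap : ContinuousAt (fun x : ℝ ↦ (x + t * I : ℂ)) σ := by fun_prop
  have hc1 : ContinuousAt (fun x : ℝ ↦ riemannZeta (x + t * I)) σ :=
    ContinuousAt.comp (f := fun x : ℝ ↦ (x + t * I : ℂ))
      (differentiableAt_riemannZeta hne).continuousAt hmap
  have hc2 : ContinuousAt (fun x : ℝ ↦ deriv riemannZeta (x + t * I)) σ :=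
    ContinuousAt.comp (f := fun x : ℝ ↦ (x + t * I : ℂ))
      ((differentiableOn_riemannZeta.deriv isOpen_compl_singleton).continuousOn.continuousAt
        (isOpen_compl_singleton.mem_nhds hne)) hmap
  have hev : ∀ᶠ x in nhdsWithin σ (Set.Ioi σ), 1 < x :=
    Filter.mem_of_superset self_mem_nhdsWithin fun x hx ↦ hσ.trans_lt hx
  have b1 := le_of_tendsto ((continuousAt_const.div hc1 hz).norm.tendsto.mono_left
    nhdsWithin_le_nhds) (hev.mono fun x hx ↦ (h x t hx ht).1)
  have b2 := le_of_tendsto ((hc2.div hc1 hz).norm.tendsto.mono_left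
    nhdsWithin_le_nhds) (hev.mono fun x hx ↦ (h x t hx ht).2)
  have p7 : 0 < Real.log t ^ 7 := by positivity
  have p9 : 0 < Real.log t ^ 9 := by positivity
  constructor
  · exact b1.trans_lt (by linarith)
  · exact b2.trans_lt (by linarith)
end
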